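/- arXiv:1904.00989 — 3 statements merged into one kernel-verified Lean document; each statement's English description precedes it below -/
import Mathlib

section
/- Finite φ-entropy characterizes the nonnegative Orlicz class (Appendix Lemma: bdd): under Assumption Φ(i), for any measurable m : 𝒰 → ℝ, ∫ φ(m(U)) dF* < ∞ if and only if m ≥ 0 F*-almost everywhere and there exists c > 0 with ∫ φ(1 + c|m(U)|) dF* < ∞. -/
open MeasureTheory Filter Set
open scoped ENNReal Pointwise Classical

noncomputable section

namespace CFSens

/-- map an extended real to `ℝ≥0∞` (negatives go to `0`; only used on nonnegative values). -/
def erealToENNReal (x : EReal) : ℝ≥0∞ := if x = ⊤ then ⊤ else ENNReal.ofReal x.toReal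

/-- Euclidean dot product. -/
def dot {ι : Type*} [Fintype ι] (a b : ι → ℝ) : ℝ := ∑ i, a i * b i

/-- Convex conjugate `φ*(x) = sup_{t ≥ 0} (t x - φ t)` (`EReal`-valued). -/
def phiStar (φ : ℝ → ℝ) (x : ℝ) : EReal :=
  ⨆ t ∈ Set.Ici (0:ℝ), ((t * x - φ t : ℝ) : EReal)

/-- Convex conjugate `(ηφ)*(x) = sup_{t ≥ 0} (t x - η φ t)` of `ηφ`, for `η ≥ 0`. -/
def etaPhiStar (φ : ℝ → ℝ) (η x : ℝ) : EReal :=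
  ⨆ t ∈ Set.Ici (0:ℝ), ((t * x - η * φ t : ℝ) : EReal)

/-- `ψ(x) = φ*(x) - x`. -/
def psi (φ : ℝ → ℝ) (x : ℝ) : EReal := phiStar φ x - (x : EReal)

/-- Assumption Φ(i).  Here `φ : ℝ → ℝ` records the (finite) values of the divergence cost
on `[0,∞)`; the paper's extension `φ(x) = +∞` for `x < 0` is encoded separately wherever it
matters (nonnegativity of densities), and `φ(0) < ∞` is automatic since `φ` is real-valued. -/
structure PhiOne (φ : ℝ → ℝ) : Prop where
  smooth : ContDiffOn ℝ 2 φ (Set.Ioi (0:ℝ))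
  sconvex : StrictConvexOn ℝ (Set.Ici (0:ℝ)) φ
  one : φ 1 = 0
  done : deriv φ 1 = 0
  superlinear : Tendsto (fun x => φ x / x) atTop atTop
  dzero : ∃ L : EReal, L < 0 ∧
    Tendsto (fun x => ((deriv φ x : ℝ) : EReal)) (nhdsWithin 0 (Set.Ioi 0)) (nhds L)
  dinfty : ∃ L : EReal, 0 < L ∧ Tendsto (fun x => ((deriv φ x : ℝ) : EReal)) atTop (nhds L)
  delta2 : ∃ L : ℝ, Tendsto (fun x => x * deriv φ x / φ x) atTop (nhds L)

variable {U : Type*} [MeasurableSpace U] {dθ d1 d2 d3 d4 : ℕ} {Γ : Type*}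

/-- Stacked moment values/multipliers `(v1,v2,v3,v4)`. -/
abbrev Vec4 (d1 d2 d3 d4 : ℕ) :=
  (Fin d1 → ℝ) × (Fin d2 → ℝ) × (Fin d3 → ℝ) × (Fin d4 → ℝ)

/-- The targeted moments `P = (P1,P2)`. -/
abbrev Vec12 (d1 d2 : ℕ) := (Fin d1 → ℝ) × (Fin d2 → ℝ)

/-- `λ'g` for stacked vectors. -/
def dot4 (a b : Vec4 d1 d2 d3 d4) : ℝ :=
  dot a.1 b.1 + dot a.2.1 b.2.1 + dot a.2.2.1 b.2.2.1 + dot a.2.2.2 b.2.2.2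

/-- dot product on `Vec12`. -/
def dot12 (a b : Vec12 d1 d2) : ℝ := dot a.1 b.1 + dot a.2 b.2

/-- `λ ∈ Λ`, i.e. the multipliers on the inequality constraints are nonnegative. -/
def inLambda (l : Vec4 d1 d2 d3 d4) : Prop := (∀ i, 0 ≤ l.1 i) ∧ (∀ i, 0 ≤ l.2.2.1 i)

/-- `λ12'P`. -/
def dotP (l : Vec4 d1 d2 d3 d4) (P : Vec12 d1 d2) : ℝ := dot l.1 P.1 + dot l.2.1 P.2

/-- The φ-divergence `D_φ(F‖F*)` (`= +∞` unless `F ≪ F*`). -/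
def Dphi (φ : ℝ → ℝ) (Fstar F : Measure U) : ℝ≥0∞ :=
  if F ≪ Fstar then ∫⁻ u, ENNReal.ofReal (φ (F.rnDeriv Fstar u).toReal) ∂Fstar else ⊤

/-- Membership in the Orlicz heart `ℰ`: `∫ ψ(c|f|) dF* < ∞` for all `c > 0`. -/
def MemE (φ : ℝ → ℝ) (Fstar : Measure U) (f : U → ℝ) : Prop :=
  Measurable f ∧ ∀ c : ℝ, 0 < c → ∫⁻ u, erealToENNReal (psi φ (c * |f u|)) ∂Fstar < ⊤

/-- The Orlicz norm `‖f‖_ψ = inf_{c>0} c⁻¹ (1 + ∫ ψ(c|f|) dF*)`. -/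
def psiNorm (φ : ℝ → ℝ) (Fstar : Measure U) (f : U → ℝ) : ℝ≥0∞ :=
  ⨅ c ∈ Set.Ioi (0:ℝ),
    (ENNReal.ofReal c)⁻¹ * (1 + ∫⁻ u, erealToENNReal (psi φ (c * |f u|)) ∂Fstar)

/-- `E^{F*}[f]` for an `EReal`-valued integrand bounded below by `-c`. -/
def eExp (Fstar : Measure U) (c : ℝ) (f : U → EReal) : EReal :=
  ((∫⁻ u, erealToENNReal (f u + (c : EReal)) ∂Fstar : ℝ≥0∞) : EReal) - (c : EReal)

/-- Sequential lower hemicontinuity of a correspondence `A` (sequences taken in `S`). -/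
def LowerHemicontinuousAt {α β : Type*} [TopologicalSpace α] [TopologicalSpace β]
    (A : α → Set β) (S : Set α) (x : α) : Prop :=
  ∀ xs : ℕ → α, (∀ n, xs n ∈ S) → Tendsto xs atTop (nhds x) →
    ∀ y ∈ A x, ∃ ys : ℕ → β, (∀ n, ys n ∈ A (xs n)) ∧ Tendsto ys atTop (nhds y)

section Model

variable (φ : ℝ → ℝ) (Fstar : Measure U)
variable (g : U → (Fin dθ → ℝ) → Γ → Vec4 d1 d2 d3 d4)
variable (k : U → (Fin dθ → ℝ) → Γ → ℝ)

/-- All components of `g(·,θ,γ)` are integrable under `F`. -/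
def GIntegrable (θ : Fin dθ → ℝ) (γ : Γ) (F : Measure U) : Prop :=
  (∀ i, Integrable (fun u => (g u θ γ).1 i) F) ∧
  (∀ i, Integrable (fun u => (g u θ γ).2.1 i) F) ∧
  (∀ i, Integrable (fun u => (g u θ γ).2.2.1 i) F) ∧
  (∀ i, Integrable (fun u => (g u θ γ).2.2.2 i) F)

/-- The model constraints (1)–(4): `E^F[g1] ≤ P1`, `E^F[g2] = P2`, `E^F[g3] ≤ 0`, `E^F[g4] = 0`. -/
def ConstraintsHold (θ : Fin dθ → ℝ) (γ : Γ) (P : Vec12 d1 d2) (F : Measure U) : Prop :=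
  GIntegrable g θ γ F ∧
  (∀ i, ∫ u, (g u θ γ).1 i ∂F ≤ P.1 i) ∧
  (∀ i, ∫ u, (g u θ γ).2.1 i ∂F = P.2 i) ∧
  (∀ i, ∫ u, (g u θ γ).2.2.1 i ∂F ≤ 0) ∧
  (∀ i, ∫ u, (g u θ γ).2.2.2 i ∂F = 0)

/-- `F ∈ N_δ` and the model constraints hold at `(θ,γ,P)` under `F`. -/
def Feasible (δ : ℝ) (θ : Fin dθ → ℝ) (γ : Γ) (P : Vec12 d1 d2) (F : Measure U) : Prop :=
  IsProbabilityMeasure F ∧ Dphi φ Fstar F ≤ ENNReal.ofReal δ ∧ ConstraintsHold g θ γ P F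

/-- `κ̲_δ(θ;γ,P)`: primal lower value (explicit-dependence case); `= ⊤` if infeasible. -/
def kappaLow (δ : ℝ) (θ : Fin dθ → ℝ) (γ : Γ) (P : Vec12 d1 d2) : EReal :=
  sInf {x : EReal | ∃ F : Measure U, Feasible φ Fstar g δ θ γ P F ∧
    Integrable (fun u => k u θ γ) F ∧ x = ((∫ u, k u θ γ ∂F : ℝ) : EReal)}

/-- `κ̄_δ(θ;γ,P)`: primal upper value (explicit-dependence case); `= ⊥` if infeasible. -/
def kappaHigh (δ : ℝ) (θ : Fin dθ → ℝ) (γ : Γ) (P : Vec12 d1 d2) : EReal :=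
  sSup {x : EReal | ∃ F : Measure U, Feasible φ Fstar g δ θ γ P F ∧
    Integrable (fun u => k u θ γ) F ∧ x = ((∫ u, k u θ γ ∂F : ℝ) : EReal)}

/-- `κ̲*_δ(θ;γ,P)`: the dual program of `κ̲_δ`.  Multipliers with
`E^{F*}[(ηφ)*(...)] = +∞` contribute `-∞` to the supremum and are omitted from the
index set; `w` is a real-valued integrable version of the conjugate integrand. -/
def kappaLowDual (δ : ℝ) (θ : Fin dθ → ℝ) (γ : Γ) (P : Vec12 d1 d2) : EReal :=
  sSup {x : EReal | ∃ η : ℝ, 0 ≤ η ∧ ∃ ζ : ℝ, ∃ l : Vec4 d1 d2 d3 d4, inLambda l ∧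
    ∃ w : U → ℝ, Integrable w Fstar ∧
      (∀ᵐ u ∂Fstar, (w u : EReal) = etaPhiStar φ η (-(k u θ γ) - ζ - dot4 l (g u θ γ))) ∧
      x = ((-(∫ u, w u ∂Fstar) - η * δ - ζ - dotP l P : ℝ) : EReal)}

/-- `κ̄*_δ(θ;γ,P)`: the dual program of `κ̄_δ`. -/
def kappaHighDual (δ : ℝ) (θ : Fin dθ → ℝ) (γ : Γ) (P : Vec12 d1 d2) : EReal :=
  sInf {x : EReal | ∃ η : ℝ, 0 ≤ η ∧ ∃ ζ : ℝ, ∃ l : Vec4 d1 d2 d3 d4, inLambda l ∧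
    ∃ w : U → ℝ, Integrable w Fstar ∧
      (∀ᵐ u ∂Fstar, (w u : EReal) = etaPhiStar φ η (k u θ γ - ζ - dot4 l (g u θ γ))) ∧
      x = (((∫ u, w u ∂Fstar) + η * δ + ζ + dotP l P : ℝ) : EReal)}

/-- `δ*(θ;γ,P) = sup_{ζ,λ∈Λ} ( -E^{F*}[φ*(-ζ-λ'g)] - ζ - λ12'P )`. -/
def deltaStar (θ : Fin dθ → ℝ) (γ : Γ) (P : Vec12 d1 d2) : EReal :=
  sSup {x : EReal | ∃ ζ : ℝ, ∃ l : Vec4 d1 d2 d3 d4, inLambda l ∧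
    ∃ w : U → ℝ, Integrable w Fstar ∧
      (∀ᵐ u ∂Fstar, (w u : EReal) = phiStar φ (-ζ - dot4 l (g u θ γ))) ∧
      x = ((-(∫ u, w u ∂Fstar) - ζ - dotP l P : ℝ) : EReal)}

/-- `{E^F[g(U,θ,γ)] : F ∈ N_∞}`. -/
def momentSet (θ : Fin dθ → ℝ) (γ : Γ) : Set (Vec4 d1 d2 d3 d4) :=
  {v | ∃ F : Measure U, IsProbabilityMeasure F ∧ Dphi φ Fstar F < ⊤ ∧ GIntegrable g θ γ F ∧
    v = ((fun i => ∫ u, (g u θ γ).1 i ∂F), (fun i => ∫ u, (g u θ γ).2.1 i ∂F),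
         (fun i => ∫ u, (g u θ γ).2.2.1 i ∂F), (fun i => ∫ u, (g u θ γ).2.2.2 i ∂F))}

/-- The cone `𝒞 = ℝ^{d1}_{≥0} × {0} × ℝ^{d3}_{≥0} × {0}`. -/
def coneC : Set (Vec4 d1 d2 d3 d4) :=
  {c | (∀ i, 0 ≤ c.1 i) ∧ c.2.1 = 0 ∧ (∀ i, 0 ≤ c.2.2.1 i) ∧ c.2.2.2 = 0}

/-- Condition S at `(θ,γ,P)`. -/
def ConditionS (θ : Fin dθ → ℝ) (γ : Γ) (P : Vec12 d1 d2) : Prop :=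
  ((P.1, P.2, (0 : Fin d3 → ℝ), (0 : Fin d4 → ℝ)) : Vec4 d1 d2 d3 d4) ∈
    interior (momentSet φ Fstar g θ γ + coneC)

/-- Assumption Φ(ii): `k(·,θ,γ)` and each component of `g(·,θ,γ)` lie in `ℰ`. -/
def PhiTwo : Prop :=
  ∀ (θ : Fin dθ → ℝ) (γ : Γ), MemE φ Fstar (fun u => k u θ γ) ∧
    (∀ i, MemE φ Fstar (fun u => (g u θ γ).1 i)) ∧
    (∀ i, MemE φ Fstar (fun u => (g u θ γ).2.1 i)) ∧
    (∀ i, MemE φ Fstar (fun u => (g u θ γ).2.2.1 i)) ∧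
    (∀ i, MemE φ Fstar (fun u => (g u θ γ).2.2.2 i))

/-- `Θ_δ = {θ ∈ Θ : δ*(θ;γ0,P0) < δ}`. -/
def ThetaDelta (Θ : Set (Fin dθ → ℝ)) (γ0 : Γ) (P0 : Vec12 d1 d2) (δ : ℝ) :
    Set (Fin dθ → ℝ) :=
  {θ ∈ Θ | deltaStar φ Fstar g θ γ0 P0 < ((δ : ℝ) : EReal)}

/-- Implicit-dependence lower value: `kI(θ,γ)` if feasible, `+∞` otherwise. -/
def kappaLowImp (kI : (Fin dθ → ℝ) → Γ → ℝ) (δ : ℝ) (θ : Fin dθ → ℝ) (γ : Γ)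
    (P : Vec12 d1 d2) : EReal :=
  sInf {x : EReal | ∃ F : Measure U, Feasible φ Fstar g δ θ γ P F ∧ x = ((kI θ γ : ℝ) : EReal)}

/-- Implicit-dependence upper value: `kI(θ,γ)` if feasible, `-∞` otherwise. -/
def kappaHighImp (kI : (Fin dθ → ℝ) → Γ → ℝ) (δ : ℝ) (θ : Fin dθ → ℝ) (γ : Γ)
    (P : Vec12 d1 d2) : EReal :=
  sSup {x : EReal | ∃ F : Measure U, Feasible φ Fstar g δ θ γ P F ∧ x = ((kI θ γ : ℝ) : EReal)}

/-- The criterion `K̲_δ(θ;γ,P)`. -/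
def KLowCrit (δ : ℝ) (θ : Fin dθ → ℝ) (γ : Γ) (P : Vec12 d1 d2) : EReal :=
  if deltaStar φ Fstar g θ γ P < ((δ : ℝ) : EReal) then kappaLowDual φ Fstar g k δ θ γ P
  else if deltaStar φ Fstar g θ γ P = ((δ : ℝ) : EReal) then kappaLow φ Fstar g k δ θ γ P
  else ⊤

/-- The criterion `K̄_δ(θ;γ,P)`. -/
def KHighCrit (δ : ℝ) (θ : Fin dθ → ℝ) (γ : Γ) (P : Vec12 d1 d2) : EReal :=
  if deltaStar φ Fstar g θ γ P < ((δ : ℝ) : EReal) then kappaHighDual φ Fstar g k δ θ γ P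
  else if deltaStar φ Fstar g θ γ P = ((δ : ℝ) : EReal) then kappaHigh φ Fstar g k δ θ γ P
  else ⊥

/-- ℰ-continuity of a family `f(·,θ,γ)` in `(θ,γ)` on `Θ × Γ`. -/
def EContinuousIn [TopologicalSpace Γ] (Θ : Set (Fin dθ → ℝ))
    (f : U → (Fin dθ → ℝ) → Γ → ℝ) : Prop :=
  ∀ θ0 ∈ Θ, ∀ γ0 : Γ,
    Tendsto (fun p : (Fin dθ → ℝ) × Γ => psiNorm φ Fstar (fun u => f u p.1 p.2 - f u θ0 γ0))
      (nhdsWithin (θ0, γ0) (Θ ×ˢ (Set.univ : Set Γ))) (nhds 0)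

/-- Assumption M(i) for the moment functions. -/
def MOneG [TopologicalSpace Γ] (Θ : Set (Fin dθ → ℝ)) : Prop :=
  (∀ i, EContinuousIn φ Fstar Θ (fun u θ γ => (g u θ γ).1 i)) ∧
  (∀ i, EContinuousIn φ Fstar Θ (fun u θ γ => (g u θ γ).2.1 i)) ∧
  (∀ i, EContinuousIn φ Fstar Θ (fun u θ γ => (g u θ γ).2.2.1 i)) ∧
  (∀ i, EContinuousIn φ Fstar Θ (fun u θ γ => (g u θ γ).2.2.2 i))

/-- Assumption M(v). -/
def MFive [TopologicalSpace Γ] (Θ : Set (Fin dθ → ℝ)) : Prop :=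
  ∀ (c1 c2 : ℝ) (c3 : Vec4 d1 d2 d3 d4), ContinuousOn
    (fun p : (Fin dθ → ℝ) × Γ =>
      eExp Fstar (φ 0) (fun u => phiStar φ (c1 + c2 * k u p.1 p.2 + dot4 c3 (g u p.1 p.2))))
    (Θ ×ˢ (Set.univ : Set Γ))

/-- Objective of the dual program for the lower value, as a function of `(η,ζ,λ)`. -/
def lowObj (δ : ℝ) (θ : Fin dθ → ℝ) (γ : Γ) (P : Vec12 d1 d2) (η ζ : ℝ)
    (l : Vec4 d1 d2 d3 d4) : EReal :=
  -(eExp Fstar (η * φ 0) (fun u => etaPhiStar φ η (-(k u θ γ) - ζ - dot4 l (g u θ γ))))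
    - ((η * δ : ℝ) : EReal) - ((ζ : ℝ) : EReal) - ((dotP l P : ℝ) : EReal)

/-- Objective of the dual program for the upper value. -/
def highObj (δ : ℝ) (θ : Fin dθ → ℝ) (γ : Γ) (P : Vec12 d1 d2) (η ζ : ℝ)
    (l : Vec4 d1 d2 d3 d4) : EReal :=
  (eExp Fstar (η * φ 0) (fun u => etaPhiStar φ η (k u θ γ - ζ - dot4 l (g u θ γ))))
    + ((η * δ : ℝ) : EReal) + ((ζ : ℝ) : EReal) + ((dotP l P : ℝ) : EReal)

/-- `Ξ̲_δ(θ)`: maximizers of the lower dual program. -/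
def XiLow (δ : ℝ) (θ : Fin dθ → ℝ) (γ : Γ) (P : Vec12 d1 d2) :
    Set (ℝ × ℝ × Vec4 d1 d2 d3 d4) :=
  {ξ | 0 ≤ ξ.1 ∧ inLambda ξ.2.2 ∧ ∀ ξ' : ℝ × ℝ × Vec4 d1 d2 d3 d4, 0 ≤ ξ'.1 → inLambda ξ'.2.2 →
    lowObj φ Fstar g k δ θ γ P ξ'.1 ξ'.2.1 ξ'.2.2 ≤ lowObj φ Fstar g k δ θ γ P ξ.1 ξ.2.1 ξ.2.2}

/-- `Ξ̄_δ(θ)`: minimizers of the upper dual program. -/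
def XiHigh (δ : ℝ) (θ : Fin dθ → ℝ) (γ : Γ) (P : Vec12 d1 d2) :
    Set (ℝ × ℝ × Vec4 d1 d2 d3 d4) :=
  {ξ | 0 ≤ ξ.1 ∧ inLambda ξ.2.2 ∧ ∀ ξ' : ℝ × ℝ × Vec4 d1 d2 d3 d4, 0 ≤ ξ'.1 → inLambda ξ'.2.2 →
    highObj φ Fstar g k δ θ γ P ξ.1 ξ.2.1 ξ.2.2 ≤ highObj φ Fstar g k δ θ γ P ξ'.1 ξ'.2.1 ξ'.2.2}

/-- `Λ̲_δ(θ)`: `(λ1,λ2)`-projections of `Ξ̲_δ(θ)`. -/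
def LamLow (δ : ℝ) (θ : Fin dθ → ℝ) (γ : Γ) (P : Vec12 d1 d2) : Set (Vec12 d1 d2) :=
  {p | ∃ ξ ∈ XiLow φ Fstar g k δ θ γ P, ξ.2.2.1 = p.1 ∧ ξ.2.2.2.1 = p.2}

/-- `Λ̄_δ(θ)`: `(λ1,λ2)`-projections of `Ξ̄_δ(θ)`. -/
def LamHigh (δ : ℝ) (θ : Fin dθ → ℝ) (γ : Γ) (P : Vec12 d1 d2) : Set (Vec12 d1 d2) :=
  {p | ∃ ξ ∈ XiHigh φ Fstar g k δ θ γ P, ξ.2.2.1 = p.1 ∧ ξ.2.2.2.1 = p.2}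

end Model

end CFSens

open CFSens

namespace CFSens.PhiOne

variable {φ : ℝ → ℝ}

lemma differentiableAt (hφ : PhiOne φ) {x : ℝ} (hx : 0 < x) : DifferentiableAt ℝ φ x :=
  (hφ.smooth.differentiableOn (by norm_num)).differentiableAt (Ioi_mem_nhds hx)

lemma nonneg (hφ : PhiOne φ) {x : ℝ} (hx : 0 ≤ x) : 0 ≤ φ x := by
  have hd : HasDerivAt φ 0 1 := hφ.done ▸ (hφ.differentiableAt one_pos).hasDerivAt
  have h1 : (1 : ℝ) ∈ Ici (0 : ℝ) := mem_Ici.2 zero_le_one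
  rcases lt_trichotomy x 1 with h | rfl | h
  · have := hφ.sconvex.convexOn.slope_le_of_hasDerivAt hx h1 h hd
    rw [slope_def_field, div_le_iff₀ (sub_pos.2 h), hφ.one] at this
    linarith
  · exact hφ.one.ge
  · have := hφ.sconvex.convexOn.le_slope_of_hasDerivAt h1 hx h hd
    rw [slope_def_field, le_div_iff₀ (sub_pos.2 h), hφ.one] at this
    linarith

lemma mono (hφ : PhiOne φ) {x y : ℝ} (hx : 1 ≤ x) (hxy : x ≤ y) : φ x ≤ φ y := by
  have hy : 0 ≤ y := by linarith
  have h := hφ.sconvex.convexOn.le_max_of_mem_Icc (mem_Ici.2 zero_le_one) hy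
    ⟨hx, hxy⟩
  rwa [hφ.one, max_eq_right (hφ.nonneg hy)] at h

lemma le_of_mem_Icc (hφ : PhiOne φ) {x b : ℝ} (hx : 0 ≤ x) (hxb : x ≤ b) :
    φ x ≤ φ 0 + φ b := by
  have hb := hx.trans hxb
  have h := hφ.sconvex.convexOn.le_max_of_mem_Icc (self_mem_Ici (a := (0 : ℝ))) hb ⟨hx, hxb⟩
  exact h.trans (max_le_add_of_nonneg (hφ.nonneg le_rfl) (hφ.nonneg hb))

/-- The `Δ₂` growth condition: `φ` grows at most polynomially under dilations. -/
lemma exists_dilation_le (hφ : PhiOne φ) :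
    ∃ (K : ℕ) (a : ℝ), 1 ≤ a ∧ ∀ x, a ≤ x → ∀ l : ℝ, 1 ≤ l → φ (l * x) ≤ l ^ K * φ x := by
  obtain ⟨L, hL⟩ := hφ.delta2
  obtain ⟨K, hK⟩ := exists_nat_gt L
  have hpos : ∀ᶠ x in atTop, 0 < φ x := by
    filter_upwards [hφ.superlinear.eventually_gt_atTop 0, eventually_gt_atTop 0] with x h1 h2
    exact (div_pos_iff_of_pos_right h2).1 h1
  obtain ⟨a, ha⟩ := eventually_atTop.1 ((hL.eventually (eventually_lt_nhds hK)).and hpos)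
  have ha' : ∀ x, max a 1 ≤ x → 0 < x := fun x hx => by linarith [(le_max_right a 1).trans hx]
  refine ⟨K, max a 1, le_max_right _ _, ?_⟩
  have hderiv : ∀ x, max a 1 ≤ x → HasDerivAt (fun y => φ y / y ^ K)
      ((deriv φ x * x ^ K - φ x * (K * x ^ (K - 1))) / (x ^ K) ^ 2) x := fun x hx =>
    (hφ.differentiableAt (ha' x hx)).hasDerivAt.div (hasDerivAt_pow K x)
      (pow_pos (ha' x hx) K).ne'
  have hanti : AntitoneOn (fun y => φ y / y ^ K) (Ici (max a 1)) := by
    refine antitoneOn_of_deriv_nonpos (convex_Ici _)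
      (fun x hx => (hderiv x hx).continuousAt.continuousWithinAt)
      (fun x hx => (hderiv x (interior_subset hx)).differentiableAt.differentiableWithinAt)
      fun x hx => ?_
    have hx := interior_subset hx
    have hx0 := ha' x hx
    obtain ⟨h1, h2⟩ := ha x ((le_max_left _ _).trans hx)
    rw [(hderiv x hx).deriv]
    refine div_nonpos_of_nonpos_of_nonneg ?_ (by positivity)
    rw [div_lt_iff₀ h2] at h1
    have hpow : K * x ^ (K - 1) * x = K * x ^ K := by
      rcases K with _ | K
      · simp
      · rw [Nat.add_sub_cancel, pow_succ]; ring
    have h3 : (deriv φ x * x ^ K - φ x * (K * x ^ (K - 1))) * x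
        = x ^ K * (x * deriv φ x - K * φ x) := by
      linear_combination -φ x * hpow
    refine nonpos_of_mul_nonpos_left ?_ hx0
    rw [h3]
    exact mul_nonpos_of_nonneg_of_nonpos (by positivity) (by linarith)
  intro x hx l hl
  have hx0 := ha' x hx
  have hxl : x ≤ l * x := le_mul_of_one_le_left hx0.le hl
  have h := hanti hx (hx.trans hxl) hxl
  have hl0 : 0 < l := by linarith
  simp only at h
  rw [div_le_div_iff₀ (by positivity) (by positivity), mul_pow] at h
  have hxK : 0 < x ^ K := by positivity
  nlinarith

end CFSens.PhiOne

lemma lintegral_ofReal_add_const_lt_top {U : Type*} [MeasurableSpace U] {μ : Measure U}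
    [IsFiniteMeasure μ] {f : U → ℝ≥0∞} (hf : ∫⁻ u, f u ∂μ < ⊤) {C b : ℝ} :
    ∫⁻ u, (ENNReal.ofReal C * f u + ENNReal.ofReal b) ∂μ < ⊤ := by
  rw [lintegral_add_right _ measurable_const, lintegral_const_mul' _ _ ENNReal.ofReal_ne_top,
    lintegral_const]
  exact ENNReal.add_lt_top.2 ⟨ENNReal.mul_lt_top ENNReal.ofReal_lt_top hf,
    ENNReal.mul_lt_top ENNReal.ofReal_lt_top (measure_lt_top _ _)⟩

/-- **Appendix Lemma: finite φ-entropy characterizes the nonnegative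
Orlicz class.**  Under Assumption Φ(i), for any measurable `m : 𝒰 → ℝ`,
`∫ φ(m(U)) dF* < ∞` (with the convention `φ = +∞` on negatives) iff `m ≥ 0` `F*`-a.e.
and `∫ φ(1 + c|m(U)|) dF* < ∞` for some `c > 0`. -/
theorem finite_phi_entropy_iff_orlicz
    {U : Type*} [MeasurableSpace U]
    (φ : ℝ → ℝ) (Fstar : Measure U) [IsProbabilityMeasure Fstar]
    (hΦ1 : PhiOne φ)
    (m : U → ℝ) (hm : Measurable m) :
    (∫⁻ u, (if m u < 0 then (⊤ : ℝ≥0∞) else ENNReal.ofReal (φ (m u))) ∂Fstar < ⊤) ↔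
    ((∀ᵐ u ∂Fstar, 0 ≤ m u) ∧
      ∃ c : ℝ, 0 < c ∧ ∫⁻ u, ENNReal.ofReal (φ (1 + c * |m u|)) ∂Fstar < ⊤) := by
  constructor
  · intro h
    have hae : ∀ᵐ u ∂Fstar, 0 ≤ m u := by
      have hs : MeasurableSet {u | m u < 0} := measurableSet_lt hm measurable_const
      have hle := lintegral_mono (μ := Fstar) (f := {u | m u < 0}.indicator fun _ => (⊤ : ℝ≥0∞))
        (g := fun u => if m u < 0 then (⊤ : ℝ≥0∞) else ENNReal.ofReal (φ (m u))) fun u => by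
          by_cases hu : m u < 0 <;> simp [hu]
      rw [lintegral_indicator_const hs] at hle
      have h0 : Fstar {u | m u < 0} = 0 := by
        by_contra hne
        rw [ENNReal.top_mul hne] at hle
        exact h.not_ge hle
      simpa [ae_iff] using h0
    refine ⟨hae, 1 / 2, by norm_num, ?_⟩
    refine (lintegral_mono_ae ?_).trans_lt
      (lintegral_ofReal_add_const_lt_top h (C := 1) (b := φ 2))
    filter_upwards [hae] with u hu
    rw [if_neg hu.not_gt, ENNReal.ofReal_one, one_mul, abs_of_nonneg hu,
      ← ENNReal.ofReal_add (hΦ1.nonneg hu) (hΦ1.nonneg zero_le_two)]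
    refine ENNReal.ofReal_le_ofReal ?_
    rcases le_total (m u) 2 with h2 | h2
    · linarith [hΦ1.mono (x := 1 + 1 / 2 * m u) (y := 2) (by linarith) (by linarith),
        hΦ1.nonneg hu]
    · linarith [hΦ1.mono (x := 1 + 1 / 2 * m u) (y := m u) (by linarith) (by linarith),
        hΦ1.nonneg zero_le_two]
  · rintro ⟨hae, c, hc, h⟩
    obtain ⟨K, a, ha1, hK⟩ := hΦ1.exists_dilation_le
    have hl : 1 ≤ 1 + 1 / c := le_add_of_nonneg_right (by positivity)
    have hb : 0 ≤ a / c + 1 := by positivity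
    have hb' : 0 ≤ φ 0 + φ (a / c + 1) := add_nonneg (hΦ1.nonneg le_rfl) (hΦ1.nonneg hb)
    refine (lintegral_mono_ae ?_).trans_lt (lintegral_ofReal_add_const_lt_top h
      (C := (1 + 1 / c) ^ K) (b := φ 0 + φ (a / c + 1)))
    filter_upwards [hae] with u hu
    have hcm : 0 ≤ c * m u := by positivity
    have hpos : 0 ≤ φ (1 + c * m u) := hΦ1.nonneg (by linarith)
    rw [if_neg hu.not_gt, abs_of_nonneg hu,
      ← ENNReal.ofReal_mul (by positivity), ← ENNReal.ofReal_add (by positivity) hb']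
    refine ENNReal.ofReal_le_ofReal ?_
    rcases le_total (m u) (a / c + 1) with h2 | h2
    · exact (hΦ1.le_of_mem_Icc hu h2).trans (le_add_of_nonneg_left (by positivity))
    · have h1 : 1 ≤ m u := by linarith [show 0 ≤ a / c by positivity]
      have hacm : a ≤ m u * c := (div_le_iff₀ hc).1 (by linarith)
      have h3 := hK (1 + c * m u) (by linarith) _ hl
      have h4 : m u ≤ (1 + 1 / c) * (1 + c * m u) := by
        have : (1 + 1 / c) * (1 + c * m u) = 1 + c * m u + 1 / c + m u := by
          field_simp
          ring
        rw [this]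
        have : 0 < 1 / c := by positivity
        linarith
      linarith [hΦ1.mono h1 h4]
end
end

section
/- Slater constraint qualifications (Appendix Lemma: cq): let Assumptions Φ(i) and Φ(ii) hold and let Condition S hold at (θ,γ,P). Then (1, P', 0_{d3+d4}')' lies in the interior of { E^{F*}[ m(U)(1, g(U,θ,γ)')' ] : m ∈ 𝓛_+ } + {0}×𝒞. If in addition I(θ;γ,P) := inf{ D_φ(F‖F*) : F a probability measure under which the model constraints hold at (θ,γ,P) } satisfies I(θ;γ,P) < δ, then (δ, 1, P', 0_{d3+d4}')' lies in the interior of { ( E^{F*}[φ(m(U))], E^{F*}[m(U)(1, g(U,θ,γ)')'] )' : m ∈ 𝓛_+ } + ℝ_{≥0}×{0}×𝒞. -/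
open MeasureTheory Filter Set
open scoped ENNReal Pointwise Classical

noncomputable section

namespace CFSens

variable {U : Type*} [MeasurableSpace U] {dθ d1 d2 d3 d4 : ℕ} {Γ : Type*}

/-- Membership in `𝓛_+`: measurable, `F*`-a.e. nonnegative, finite Orlicz integral. -/
def MemLPlus (φ : ℝ → ℝ) (Fstar : Measure U) (m : U → ℝ) : Prop :=
  Measurable m ∧ (∀ᵐ u ∂Fstar, 0 ≤ m u) ∧
    ∃ c : ℝ, 0 < c ∧ ∫⁻ u, ENNReal.ofReal (φ (1 + c * |m u|)) ∂Fstar < ⊤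

/-- Integrability of `m` and of `m·g` under `F*` (automatic by Hölder's inequality
for Orlicz classes). -/
def MIntegrable (Fstar : Measure U) (g : U → (Fin dθ → ℝ) → Γ → Vec4 d1 d2 d3 d4)
    (θ : Fin dθ → ℝ) (γ : Γ) (m : U → ℝ) : Prop :=
  Integrable m Fstar ∧
  (∀ i, Integrable (fun u => m u * (g u θ γ).1 i) Fstar) ∧
  (∀ i, Integrable (fun u => m u * (g u θ γ).2.1 i) Fstar) ∧
  (∀ i, Integrable (fun u => m u * (g u θ γ).2.2.1 i) Fstar) ∧
  (∀ i, Integrable (fun u => m u * (g u θ γ).2.2.2 i) Fstar)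

/-- `{ E^{F*}[m(U)(1, g(U,θ,γ)')'] : m ∈ 𝓛_+ }`. -/
def momentSetL (φ : ℝ → ℝ) (Fstar : Measure U)
    (g : U → (Fin dθ → ℝ) → Γ → Vec4 d1 d2 d3 d4) (θ : Fin dθ → ℝ) (γ : Γ) :
    Set (ℝ × Vec4 d1 d2 d3 d4) :=
  {v | ∃ m : U → ℝ, MemLPlus φ Fstar m ∧ MIntegrable Fstar g θ γ m ∧
    v = (∫ u, m u ∂Fstar,
         (fun i => ∫ u, m u * (g u θ γ).1 i ∂Fstar),
         (fun i => ∫ u, m u * (g u θ γ).2.1 i ∂Fstar),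
         (fun i => ∫ u, m u * (g u θ γ).2.2.1 i ∂Fstar),
         (fun i => ∫ u, m u * (g u θ γ).2.2.2 i ∂Fstar))}

/-- `{ ( E^{F*}[φ(m(U))], E^{F*}[m(U)(1, g(U,θ,γ)')'] ) : m ∈ 𝓛_+ }`. -/
def momentSetLPhi (φ : ℝ → ℝ) (Fstar : Measure U)
    (g : U → (Fin dθ → ℝ) → Γ → Vec4 d1 d2 d3 d4) (θ : Fin dθ → ℝ) (γ : Γ) :
    Set (ℝ × ℝ × Vec4 d1 d2 d3 d4) :=
  {v | ∃ m : U → ℝ, MemLPlus φ Fstar m ∧ MIntegrable Fstar g θ γ m ∧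
    Integrable (fun u => φ (m u)) Fstar ∧
    v = (∫ u, φ (m u) ∂Fstar, ∫ u, m u ∂Fstar,
         (fun i => ∫ u, m u * (g u θ γ).1 i ∂Fstar),
         (fun i => ∫ u, m u * (g u θ γ).2.1 i ∂Fstar),
         (fun i => ∫ u, m u * (g u θ γ).2.2.1 i ∂Fstar),
         (fun i => ∫ u, m u * (g u θ γ).2.2.2 i ∂Fstar))}

/-- `{0} × 𝒞`. -/
def coneC1 : Set (ℝ × Vec4 d1 d2 d3 d4) := {c | c.1 = 0 ∧ c.2 ∈ coneC}

/-- `ℝ_{≥0} × {0} × 𝒞`. -/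
def coneC2 : Set (ℝ × ℝ × Vec4 d1 d2 d3 d4) := {c | 0 ≤ c.1 ∧ c.2.1 = 0 ∧ c.2.2 ∈ coneC}

/-- `I(θ;γ,P) = inf { D_φ(F‖F*) : F a probability measure satisfying the constraints }`. -/
def Ifun (φ : ℝ → ℝ) (Fstar : Measure U) (g : U → (Fin dθ → ℝ) → Γ → Vec4 d1 d2 d3 d4)
    (θ : Fin dθ → ℝ) (γ : Γ) (P : Vec12 d1 d2) : ℝ≥0∞ :=
  sInf {d : ℝ≥0∞ | ∃ F : Measure U, IsProbabilityMeasure F ∧ ConstraintsHold g θ γ P F ∧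
    d = Dphi φ Fstar F}

end CFSens

open CFSens

/-- A convex set that is bounded below and upward closed in its first coordinate contains in its
interior every point lying strictly above one of its points over the interior of its shadow. -/
theorem mem_interior_of_lt_of_convex {E : Type*} [NormedAddCommGroup E] [NormedSpace ℝ E]
    [FiniteDimensional ℝ E] {A : Set (ℝ × E)} (hA : Convex ℝ A)
    (hup : ∀ r s : ℝ, ∀ v, (r, v) ∈ A → r ≤ s → (s, v) ∈ A)
    (hlow : ∀ x ∈ A, 0 ≤ x.1) {r δ : ℝ} {v : E} (hrv : (r, v) ∈ A) (hrδ : r < δ)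
    (hv : v ∈ interior (Prod.snd '' A)) : (δ, v) ∈ interior A := by
  set S : Set E := Prod.snd '' A with hSdef
  set f : E → ℝ := fun w => sInf {t : ℝ | (t, w) ∈ A} with hf
  have hbdd : ∀ w, BddBelow {t : ℝ | (t, w) ∈ A} := fun w => ⟨0, fun t ht => hlow _ ht⟩
  have hS : Convex ℝ S := by
    simpa [hSdef] using hA.linear_image (LinearMap.snd ℝ ℝ E)
  have hne : ∀ w ∈ S, {t : ℝ | (t, w) ∈ A}.Nonempty := by
    rintro _ ⟨⟨t, w⟩, h, rfl⟩
    exact ⟨t, h⟩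
  have hmem : ∀ w ∈ S, ∀ t, f w < t → (t, w) ∈ A := by
    intro w hw t ht
    obtain ⟨s, hs, hst⟩ := exists_lt_of_csInf_lt (hne w hw) ht
    exact hup s t w hs hst.le
  have hconv : ConvexOn ℝ S f := by
    refine ⟨hS, fun x hx y hy a b ha hb hab => le_of_forall_pos_le_add fun ε hε => ?_⟩
    have h1 := hmem x hx (f x + ε) (by linarith)
    have h2 := hmem y hy (f y + ε) (by linarith)
    have h3 : (a * (f x + ε) + b * (f y + ε), a • x + b • y) ∈ A := by
      simpa using hA h1 h2 ha hb hab
    have h4 : f (a • x + b • y) ≤ a * (f x + ε) + b * (f y + ε) := csInf_le (hbdd _) h3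
    calc f (a • x + b • y) ≤ a * (f x + ε) + b * (f y + ε) := h4
      _ = a • f x + b • f y + (a + b) * ε := by simp only [smul_eq_mul]; ring
      _ = a • f x + b • f y + ε := by rw [hab, one_mul]
  have hcont : ContinuousAt f v :=
    hconv.continuousOn_interior.continuousAt (isOpen_interior.mem_nhds hv)
  have hfv : f v < δ := (csInf_le (hbdd v) hrv).trans_lt hrδ
  rw [mem_interior_iff_mem_nhds]
  have h1 : ∀ᶠ x : ℝ × E in nhds (δ, v), f x.2 < x.1 :=
    Tendsto.eventually_lt (hcont.tendsto.comp (continuous_snd.tendsto (δ, v)))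
      (continuous_fst.tendsto (δ, v)) hfv
  have h2 : ∀ᶠ x : ℝ × E in nhds (δ, v), x.2 ∈ interior S :=
    (continuous_snd.tendsto (δ, v)).eventually (isOpen_interior.mem_nhds hv)
  filter_upwards [h1, h2] with x hx1 hx2
  exact hmem x.2 (interior_subset hx2) x.1 hx1

/-- A convex set containing a point at height `0` and a point at height `2` contains in its
interior every interior point of its slice at height `1`. -/
theorem mem_interior_of_mem_interior_slice {E : Type*} [NormedAddCommGroup E] [NormedSpace ℝ E]
    {S : Set (ℝ × E)} (hS : Convex ℝ S) {x y p : E} (h0 : ((0 : ℝ), x) ∈ S)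
    (h2 : ((2 : ℝ), y) ∈ S) (hp : p ∈ interior {w : E | ((1 : ℝ), w) ∈ S}) :
    ((1 : ℝ), p) ∈ interior S := by
  rw [mem_interior_iff_mem_nhds] at hp ⊢
  have hdown : ∀ᶠ z : ℝ × E in nhds ((1 : ℝ), p),
      ((1 : ℝ), z.1⁻¹ • (z.2 - (1 - z.1) • x)) ∈ S := by
    have hc : ContinuousAt (fun z : ℝ × E => z.1⁻¹ • (z.2 - (1 - z.1) • x)) ((1 : ℝ), p) := by
      refine ContinuousAt.smul (ContinuousAt.inv₀ (by fun_prop) (by simp)) (by fun_prop)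
    exact hc.eventually_mem (by simpa using hp)
  have hup : ∀ᶠ z : ℝ × E in nhds ((1 : ℝ), p),
      ((1 : ℝ), (2 - z.1)⁻¹ • (z.2 - (z.1 - 1) • y)) ∈ S := by
    have hc : ContinuousAt (fun z : ℝ × E => (2 - z.1)⁻¹ • (z.2 - (z.1 - 1) • y))
        ((1 : ℝ), p) := by
      refine ContinuousAt.smul (ContinuousAt.inv₀ (by fun_prop) (by norm_num)) (by fun_prop)
    have hval : (2 - (1 : ℝ))⁻¹ • (p - ((1 : ℝ) - 1) • y) = p := by norm_num
    exact hc.eventually_mem (s := {w : E | ((1 : ℝ), w) ∈ S}) (hval.symm ▸ hp)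
  have hpos : ∀ᶠ z : ℝ × E in nhds ((1 : ℝ), p), 0 < z.1 :=
    (continuous_fst.tendsto ((1 : ℝ), p)).eventually (lt_mem_nhds one_pos)
  have hlt : ∀ᶠ z : ℝ × E in nhds ((1 : ℝ), p), z.1 < 2 :=
    (continuous_fst.tendsto ((1 : ℝ), p)).eventually (gt_mem_nhds one_lt_two)
  filter_upwards [hdown, hup, hpos, hlt] with z hd hu hz0 hz2
  rcases le_total z.1 1 with h | h
  · have := hS h0 hd (sub_nonneg.2 h) hz0.le (by ring)
    convert this using 1
    ext
    · simp
    · simp [smul_smul, mul_inv_cancel₀ hz0.ne']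
  · have hz : 0 < 2 - z.1 := by linarith
    have := hS h2 hu (sub_nonneg.2 h) hz.le (by ring)
    convert this using 1
    ext
    · simp; ring
    · simp [smul_smul, mul_inv_cancel₀ hz.ne']

namespace CFSens

variable {U : Type*} [MeasurableSpace U] {dθ d1 d2 d3 d4 : ℕ} {Γ : Type*}
  {φ : ℝ → ℝ} {Fstar : Measure U} {g : U → (Fin dθ → ℝ) → Γ → Vec4 d1 d2 d3 d4}
  {θ : Fin dθ → ℝ} {γ : Γ}

theorem PhiOne.nonneg_s18 (h : PhiOne φ) {x : ℝ} (hx : 0 ≤ x) : 0 ≤ φ x := by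
  have hdiff : DifferentiableAt ℝ φ 1 :=
    (h.smooth.contDiffAt (Ioi_mem_nhds one_pos)).differentiableAt (by norm_num)
  have hd : HasDerivAt φ 0 1 := h.done ▸ hdiff.hasDerivAt
  have hmin : IsMinOn φ (Ici 0) 1 := by
    refine h.sconvex.convexOn.isMinOn_of_rightDeriv_eq_zero (by simp) ?_
    exact hd.hasDerivWithinAt.derivWithin (uniqueDiffWithinAt_Ioi 1)
  simpa [h.one] using hmin hx

theorem PhiOne.convex_le (h : PhiOne φ) {x y a b : ℝ} (hx : 0 ≤ x) (hy : 0 ≤ y) (ha : 0 ≤ a)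
    (hb : 0 ≤ b) (hab : a + b = 1) : φ (a * x + b * y) ≤ a * φ x + b * φ y := by
  simpa using h.sconvex.convexOn.2 hx hy ha hb hab

theorem PhiOne.aestronglyMeasurable_comp (h : PhiOne φ) {m : U → ℝ} (hm : Measurable m)
    (hm0 : ∀ᵐ u ∂Fstar, 0 ≤ m u) : AEStronglyMeasurable (fun u => φ (m u)) Fstar := by
  have hmeas : Measurable ((Ioi (0 : ℝ)).piecewise φ (fun _ => φ 0)) :=
    ContinuousOn.measurable_piecewise h.smooth.continuousOn continuousOn_const measurableSet_Ioi
  refine ⟨_, (hmeas.comp hm).stronglyMeasurable, ?_⟩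
  filter_upwards [hm0] with u hu
  rcases hu.eq_or_lt with h0 | h0
  · simp [← h0]
  · simp [h0]

theorem PhiOne.memLPlus (h : PhiOne φ) [IsFiniteMeasure Fstar] {m : U → ℝ} (hm : Measurable m)
    (hm0 : ∀ᵐ u ∂Fstar, 0 ≤ m u) (hint : Integrable (fun u => φ (m u)) Fstar) :
    MemLPlus φ Fstar m := by
  refine ⟨hm, hm0, 1 / 2, by norm_num, ?_⟩
  have hbound : Integrable (fun u => 1 / 2 * φ 2 + 1 / 2 * φ (m u)) Fstar :=
    (integrable_const _).add (hint.const_mul _)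
  refine (lintegral_mono_ae ?_).trans_lt hbound.lintegral_lt_top
  filter_upwards [hm0] with u hu
  refine ENNReal.ofReal_le_ofReal ?_
  have := h.convex_le (x := 2) (y := m u) (a := 1 / 2) (b := 1 / 2) (by norm_num) hu
    (by norm_num) (by norm_num) (by norm_num)
  rw [abs_of_nonneg hu]
  convert this using 2
  norm_num

theorem psi_ge (φ : ℝ → ℝ) (x : ℝ) : ((x - φ 2 : ℝ) : EReal) ≤ psi φ x := by
  have h : ((2 * x - φ 2 : ℝ) : EReal) ≤ phiStar φ x :=
    le_iSup₂_of_le (f := fun (t : ℝ) (_ : t ∈ Ici (0 : ℝ)) => ((t * x - φ t : ℝ) : EReal))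
      2 (by simp) le_rfl
  calc ((x - φ 2 : ℝ) : EReal) = ((2 * x - φ 2 : ℝ) : EReal) - (x : EReal) := by
        rw [← EReal.coe_sub]; congr 1; ring
    _ ≤ psi φ x := EReal.sub_le_sub h le_rfl

theorem ofReal_le_erealToENNReal {r : ℝ} {x : EReal} (h : (r : EReal) ≤ x) :
    ENNReal.ofReal r ≤ erealToENNReal x := by
  induction x with
  | bot => exact absurd h (by simp)
  | top => simp [erealToENNReal]
  | coe x =>
    have : r ≤ x := by exact_mod_cast h
    simpa [erealToENNReal] using ENNReal.ofReal_le_ofReal this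

theorem MemE.integrable [IsFiniteMeasure Fstar] {f : U → ℝ} (hf : MemE φ Fstar f) :
    Integrable f Fstar := by
  refine ⟨hf.1.aestronglyMeasurable, ?_⟩
  have h1 := hf.2 1 one_pos
  have hle : ∀ u, ENNReal.ofReal |f u| ≤
      erealToENNReal (psi φ (1 * |f u|)) + ENNReal.ofReal (φ 2) := by
    intro u
    calc ENNReal.ofReal |f u| = ENNReal.ofReal ((1 * |f u| - φ 2) + φ 2) := by congr 1; ring
      _ ≤ ENNReal.ofReal (1 * |f u| - φ 2) + ENNReal.ofReal (φ 2) := ENNReal.ofReal_add_le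
      _ ≤ _ := by gcongr; exact ofReal_le_erealToENNReal (psi_ge φ _)
  rw [hasFiniteIntegral_iff_norm]
  calc ∫⁻ u, ENNReal.ofReal ‖f u‖ ∂Fstar
      ≤ ∫⁻ u, (erealToENNReal (psi φ (1 * |f u|)) + ENNReal.ofReal (φ 2)) ∂Fstar :=
        lintegral_mono hle
    _ = ∫⁻ u, erealToENNReal (psi φ (1 * |f u|)) ∂Fstar + ∫⁻ _, ENNReal.ofReal (φ 2) ∂Fstar :=
        lintegral_add_right _ measurable_const
    _ < ⊤ := by
        refine ENNReal.add_lt_top.2 ⟨h1, ?_⟩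
        rw [lintegral_const]
        exact ENNReal.mul_lt_top ENNReal.ofReal_lt_top (measure_lt_top _ _)

/-- The points `(r, v)` lying above the moment vector of a density `m` of finite divergence, in the
order given by `ℝ_{≥0} × {0} × 𝒞`. -/
def epiMoments (φ : ℝ → ℝ) (Fstar : Measure U) (g : U → (Fin dθ → ℝ) → Γ → Vec4 d1 d2 d3 d4)
    (θ : Fin dθ → ℝ) (γ : Γ) : Set (ℝ × ℝ × Vec4 d1 d2 d3 d4) :=
  {x | ∃ m : U → ℝ, Measurable m ∧ (∀ᵐ u ∂Fstar, 0 ≤ m u) ∧ MIntegrable Fstar g θ γ m ∧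
    Integrable (fun u => φ (m u)) Fstar ∧ ∫ u, φ (m u) ∂Fstar ≤ x.1 ∧ ∫ u, m u ∂Fstar = x.2.1 ∧
    (∀ i, ∫ u, m u * (g u θ γ).1 i ∂Fstar ≤ x.2.2.1 i) ∧
    (∀ i, ∫ u, m u * (g u θ γ).2.1 i ∂Fstar = x.2.2.2.1 i) ∧
    (∀ i, ∫ u, m u * (g u θ γ).2.2.1 i ∂Fstar ≤ x.2.2.2.2.1 i) ∧
    (∀ i, ∫ u, m u * (g u θ γ).2.2.2 i ∂Fstar = x.2.2.2.2.2 i)}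

theorem epiMoments_subset (h : PhiOne φ) [IsFiniteMeasure Fstar] :
    epiMoments φ Fstar g θ γ ⊆ momentSetLPhi φ Fstar g θ γ + coneC2 := by
  rintro ⟨r, s, v1, v2, v3, v4⟩ ⟨m, hm, hm0, hmi, hφi, hr, hs, h1, h2, h3, h4⟩
  refine Set.mem_add.2 ⟨_, ⟨m, h.memLPlus hm hm0 hφi, hmi, hφi, rfl⟩,
    (r - ∫ u, φ (m u) ∂Fstar, 0, (fun i => v1 i - ∫ u, m u * (g u θ γ).1 i ∂Fstar), 0,
      (fun i => v3 i - ∫ u, m u * (g u θ γ).2.2.1 i ∂Fstar), 0), ?_, ?_⟩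
  · exact ⟨sub_nonneg.2 hr, rfl, fun i => sub_nonneg.2 (h1 i), rfl,
      fun i => sub_nonneg.2 (h3 i), rfl⟩
  · ext i
    · simp
    · simpa using hs
    · simp
    · simpa using h2 i
    · simp
    · simpa using h4 i

theorem snd_image_momentSetLPhi_add_subset :
    Prod.snd '' (momentSetLPhi φ Fstar g θ γ + coneC2) ⊆ momentSetL φ Fstar g θ γ + coneC1 := by
  rintro _ ⟨_, ⟨_, ⟨m, hm, hmi, -, rfl⟩, c, hc, rfl⟩, rfl⟩
  exact Set.mem_add.2 ⟨_, ⟨m, hm, hmi, rfl⟩, c.2, hc.2, rfl⟩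

theorem epiMoments_nonneg (h : PhiOne φ) {x : ℝ × ℝ × Vec4 d1 d2 d3 d4}
    (hx : x ∈ epiMoments φ Fstar g θ γ) : 0 ≤ x.1 := by
  obtain ⟨m, -, hm0, -, -, hr, -⟩ := hx
  refine (integral_nonneg_of_ae ?_).trans hr
  filter_upwards [hm0] with u hu using h.nonneg_s18 hu

theorem epiMoments_mono {r s : ℝ} {v : ℝ × Vec4 d1 d2 d3 d4}
    (hv : (r, v) ∈ epiMoments φ Fstar g θ γ) (hrs : r ≤ s) :
    (s, v) ∈ epiMoments φ Fstar g θ γ := by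
  obtain ⟨m, hm, hm0, hmi, hφi, hr, h⟩ := hv
  exact ⟨m, hm, hm0, hmi, hφi, le_trans hr hrs, h⟩

theorem integrable_combo_mul {m n f : U → ℝ} (a b : ℝ) (hm : Integrable (fun u => m u * f u) Fstar)
    (hn : Integrable (fun u => n u * f u) Fstar) :
    Integrable (fun u => (a * m u + b * n u) * f u) Fstar := by
  refine ((hm.const_mul a).add (hn.const_mul b)).congr (ae_of_all _ fun u => ?_)
  simp only [Pi.add_apply]
  ring

theorem integral_combo_mul {m n f : U → ℝ} (a b : ℝ) (hm : Integrable (fun u => m u * f u) Fstar)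
    (hn : Integrable (fun u => n u * f u) Fstar) :
    ∫ u, (a * m u + b * n u) * f u ∂Fstar =
      a * ∫ u, m u * f u ∂Fstar + b * ∫ u, n u * f u ∂Fstar := by
  rw [← integral_const_mul, ← integral_const_mul,
    ← integral_add (hm.const_mul a) (hn.const_mul b)]
  congr 1 with u
  ring

theorem convex_epiMoments (h : PhiOne φ) : Convex ℝ (epiMoments φ Fstar g θ γ) := by
  rintro x ⟨m, hm, hm0, ⟨mi, mi1, mi2, mi3, mi4⟩, hφm, mr, ms, m1, m2, m3, m4⟩
    y ⟨n, hn, hn0, ⟨ni, ni1, ni2, ni3, ni4⟩, hφn, nr, ns, n1, n2, n3, n4⟩ a b ha hb hab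
  have hpos : ∀ᵐ u ∂Fstar, 0 ≤ a * m u + b * n u := by
    filter_upwards [hm0, hn0] with u hu hu'
    positivity
  have hmeas : Measurable fun u => a * m u + b * n u := (hm.const_mul a).add (hn.const_mul b)
  have hle : ∀ᵐ u ∂Fstar, φ (a * m u + b * n u) ≤ a * φ (m u) + b * φ (n u) := by
    filter_upwards [hm0, hn0] with u hu hu' using h.convex_le hu hu' ha hb hab
  have hbound : Integrable (fun u => a * φ (m u) + b * φ (n u)) Fstar :=
    (hφm.const_mul a).add (hφn.const_mul b)
  have hφ : Integrable (fun u => φ (a * m u + b * n u)) Fstar := by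
    refine hbound.mono' (h.aestronglyMeasurable_comp hmeas hpos) ?_
    filter_upwards [hle, hpos] with u hu hu'
    rwa [Real.norm_of_nonneg (h.nonneg_s18 hu')]
  refine ⟨fun u => a * m u + b * n u, hmeas, hpos,
    ⟨(mi.const_mul a).add (ni.const_mul b), fun i => integrable_combo_mul a b (mi1 i) (ni1 i),
      fun i => integrable_combo_mul a b (mi2 i) (ni2 i),
      fun i => integrable_combo_mul a b (mi3 i) (ni3 i),
      fun i => integrable_combo_mul a b (mi4 i) (ni4 i)⟩, hφ, ?_, ?_, fun i => ?_, fun i => ?_,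
    fun i => ?_, fun i => ?_⟩
  · refine (integral_mono_ae hφ hbound hle).trans ?_
    rw [integral_add (hφm.const_mul a) (hφn.const_mul b), integral_const_mul, integral_const_mul]
    exact add_le_add (mul_le_mul_of_nonneg_left mr ha) (mul_le_mul_of_nonneg_left nr hb)
  · rw [integral_add (mi.const_mul a) (ni.const_mul b), integral_const_mul, integral_const_mul,
      ms, ns]
    rfl
  · rw [integral_combo_mul a b (mi1 i) (ni1 i)]
    exact add_le_add (mul_le_mul_of_nonneg_left (m1 i) ha) (mul_le_mul_of_nonneg_left (n1 i) hb)
  · rw [integral_combo_mul a b (mi2 i) (ni2 i), m2, n2]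
    rfl
  · rw [integral_combo_mul a b (mi3 i) (ni3 i)]
    exact add_le_add (mul_le_mul_of_nonneg_left (m3 i) ha) (mul_le_mul_of_nonneg_left (n3 i) hb)
  · rw [integral_combo_mul a b (mi4 i) (ni4 i), m4, n4]
    rfl

theorem mem_epiMoments_const [IsFiniteMeasure Fstar] (hg : GIntegrable g θ γ Fstar) {t : ℝ}
    (ht : 0 ≤ t) : ∃ r v, (r, t * Fstar.real univ, v) ∈ epiMoments φ Fstar g θ γ := by
  refine ⟨∫ _, φ t ∂Fstar, ((fun i => ∫ u, t * (g u θ γ).1 i ∂Fstar),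
    (fun i => ∫ u, t * (g u θ γ).2.1 i ∂Fstar), (fun i => ∫ u, t * (g u θ γ).2.2.1 i ∂Fstar),
    (fun i => ∫ u, t * (g u θ γ).2.2.2 i ∂Fstar)), fun _ => t, measurable_const,
    ae_of_all _ fun _ => ht, ⟨integrable_const _, fun i => (hg.1 i).const_mul t,
      fun i => (hg.2.1 i).const_mul t, fun i => (hg.2.2.1 i).const_mul t,
      fun i => (hg.2.2.2 i).const_mul t⟩, integrable_const _, le_rfl, ?_, fun _ => le_rfl,
    fun _ => rfl, fun _ => le_rfl, fun _ => rfl⟩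
  simp [mul_comm]

/-- A distribution of finite divergence contributes its moment vector, at the height of its
divergence. -/
theorem mem_epiMoments_of_Dphi_lt_top (h : PhiOne φ) [IsFiniteMeasure Fstar] {F : Measure U}
    [IsProbabilityMeasure F] (hD : Dphi φ Fstar F < ⊤) (hg : GIntegrable g θ γ F)
    {v : Vec4 d1 d2 d3 d4} (h1 : ∀ i, ∫ u, (g u θ γ).1 i ∂F ≤ v.1 i)
    (h2 : ∀ i, ∫ u, (g u θ γ).2.1 i ∂F = v.2.1 i)
    (h3 : ∀ i, ∫ u, (g u θ γ).2.2.1 i ∂F ≤ v.2.2.1 i)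
    (h4 : ∀ i, ∫ u, (g u θ γ).2.2.2 i ∂F = v.2.2.2 i) :
    ((Dphi φ Fstar F).toReal, (1 : ℝ), v) ∈ epiMoments φ Fstar g θ γ := by
  have hac : F ≪ Fstar := by
    by_contra hc
    simp [Dphi, hc] at hD
  rw [Dphi, if_pos hac] at hD ⊢
  have hmeas : Measurable fun u => (F.rnDeriv Fstar u).toReal :=
    (Measure.measurable_rnDeriv F Fstar).ennreal_toReal
  have hpos : ∀ u, 0 ≤ φ (F.rnDeriv Fstar u).toReal := fun u => h.nonneg_s18 ENNReal.toReal_nonneg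
  have haesm := h.aestronglyMeasurable_comp (Fstar := Fstar) hmeas
    (ae_of_all _ fun u => ENNReal.toReal_nonneg)
  have hint : Integrable (fun u => φ (F.rnDeriv Fstar u).toReal) Fstar :=
    ⟨haesm, (hasFiniteIntegral_iff_ofReal (ae_of_all _ hpos)).2 hD⟩
  have hmom : ∀ f : U → ℝ, ∫ u, (F.rnDeriv Fstar u).toReal * f u ∂Fstar = ∫ u, f u ∂F :=
    fun f => integral_rnDeriv_smul hac
  refine ⟨fun u => (F.rnDeriv Fstar u).toReal, hmeas, ae_of_all _ fun u => ENNReal.toReal_nonneg,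
    ⟨Measure.integrable_toReal_rnDeriv,
      fun i => (integrable_rnDeriv_smul_iff hac).2 (hg.1 i),
      fun i => (integrable_rnDeriv_smul_iff hac).2 (hg.2.1 i),
      fun i => (integrable_rnDeriv_smul_iff hac).2 (hg.2.2.1 i),
      fun i => (integrable_rnDeriv_smul_iff hac).2 (hg.2.2.2 i)⟩, hint,
    (integral_eq_lintegral_of_nonneg_ae (ae_of_all _ hpos) haesm).le, ?_,
    fun i => (hmom _).trans_le (h1 i), fun i => (hmom _).trans (h2 i),
    fun i => (hmom _).trans_le (h3 i), fun i => (hmom _).trans (h4 i)⟩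
  simp [Measure.integral_toReal_rnDeriv hac]

theorem mem_interior_snd_image_epiMoments (h : PhiOne φ) [IsProbabilityMeasure Fstar]
    (hg : GIntegrable g θ γ Fstar) {P : Vec12 d1 d2} (hS : ConditionS φ Fstar g θ γ P) :
    ((1 : ℝ), (P.1, P.2, (0 : Fin d3 → ℝ), (0 : Fin d4 → ℝ))) ∈
      interior (Prod.snd '' epiMoments φ Fstar g θ γ) := by
  obtain ⟨r0, v0, h0⟩ := mem_epiMoments_const (φ := φ) hg le_rfl
  obtain ⟨r2, v2, h2⟩ := mem_epiMoments_const (φ := φ) hg zero_le_two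
  have hconv : Convex ℝ (Prod.snd '' epiMoments φ Fstar g θ γ) := by
    simpa using (convex_epiMoments (Fstar := Fstar) (g := g) (θ := θ) (γ := γ) h).linear_image
      (LinearMap.snd ℝ ℝ (ℝ × Vec4 d1 d2 d3 d4))
  refine mem_interior_of_mem_interior_slice hconv (x := v0) (y := v2)
    ⟨_, h0, by simp⟩ ⟨_, h2, by simp⟩ (interior_mono ?_ hS)
  rintro _ ⟨_, ⟨F, hF, hD, hgF, rfl⟩, c, ⟨hc1, hc2, hc3, hc4⟩, rfl⟩
  refine ⟨_, mem_epiMoments_of_Dphi_lt_top h hD hgF ?_ ?_ ?_ ?_, rfl⟩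
  · exact fun i => by simpa using hc1 i
  · exact fun i => by simp [hc2]
  · exact fun i => by simpa using hc3 i
  · exact fun i => by simp [hc4]

end CFSens


/-- **Appendix Lemma: Slater constraint qualifications.**
Under Assumptions Φ(i) and Φ(ii) and Condition S at `(θ,γ,P)`:
`(1,P,0)` lies in the interior of `{E^{F*}[m(1,g')'] : m ∈ 𝓛_+} + {0}×𝒞`; and if moreover
`I(θ;γ,P) < δ` then `(δ,1,P,0)` lies in the interior of
`{(E^{F*}[φ(m)], E^{F*}[m(1,g')']) : m ∈ 𝓛_+} + ℝ_{≥0}×{0}×𝒞`. -/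
theorem slater_constraint_qualifications
    {U : Type*} [MeasurableSpace U] {dθ d1 d2 d3 d4 : ℕ} {Γ : Type*}
    (φ : ℝ → ℝ) (Fstar : Measure U) [IsProbabilityMeasure Fstar]
    (g : U → (Fin dθ → ℝ) → Γ → Vec4 d1 d2 d3 d4)
    (k : U → (Fin dθ → ℝ) → Γ → ℝ)
    (hΦ1 : PhiOne φ)
    (hΦ2 : PhiTwo φ Fstar g k)
    (θ : Fin dθ → ℝ) (γ : Γ) (P : Vec12 d1 d2)
    (hS : ConditionS φ Fstar g θ γ P) :
    (((1 : ℝ), (P.1, P.2, (0 : Fin d3 → ℝ), (0 : Fin d4 → ℝ))) ∈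
      interior (momentSetL φ Fstar g θ γ + coneC1)) ∧
    (∀ δ : ℝ, Ifun φ Fstar g θ γ P < ENNReal.ofReal δ →
      ((δ, (1 : ℝ), (P.1, P.2, (0 : Fin d3 → ℝ), (0 : Fin d4 → ℝ))) ∈
        interior (momentSetLPhi φ Fstar g θ γ + coneC2))) := by
  have hg : GIntegrable g θ γ Fstar :=
    ⟨fun i => ((hΦ2 θ γ).2.1 i).integrable, fun i => ((hΦ2 θ γ).2.2.1 i).integrable,
      fun i => ((hΦ2 θ γ).2.2.2.1 i).integrable, fun i => ((hΦ2 θ γ).2.2.2.2 i).integrable⟩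
  have hint := mem_interior_snd_image_epiMoments hΦ1 hg hS
  have hsub := epiMoments_subset (Fstar := Fstar) (g := g) (θ := θ) (γ := γ) hΦ1
  refine ⟨interior_mono ((image_mono hsub).trans snd_image_momentSetLPhi_add_subset) hint,
    fun δ hδ => ?_⟩
  obtain ⟨_, ⟨F, hF, ⟨hgF, h1, h2, h3, h4⟩, rfl⟩, hlt⟩ := sInf_lt_iff.1 hδ
  exact interior_mono hsub (mem_interior_of_lt_of_convex (convex_epiMoments hΦ1)
    (fun r s v hv hrs => epiMoments_mono hv hrs) (fun x hx => epiMoments_nonneg hΦ1 hx)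
    (mem_epiMoments_of_Dphi_lt_top hΦ1 (hlt.trans ENNReal.ofReal_lt_top) hgF h1 h2 h3 h4)
    ((ENNReal.lt_ofReal_iff_toReal_lt (hlt.trans ENNReal.ofReal_lt_top).ne).1 hlt) hint)
end
end

section
/- Continuity of the minimal divergence function (Appendix Lemma: phi-cts): under Assumptions Φ(i) and Φ(ii), if the map (θ,γ) ↦ E^{F*}[φ*(c1 + c2'g(U,θ,γ))] is continuous for every (c1,c2) ∈ ℝ×ℝ^d and Condition S holds at (θ,γ,P), then the function (θ̃,γ̃,P̃) ↦ δ*(θ̃;γ̃,P̃) is continuous at (θ,γ,P). -/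
open MeasureTheory Filter Set
open scoped ENNReal Pointwise Classical

noncomputable section

section Convex

variable {E : Type*} [NormedAddCommGroup E] [NormedSpace ℝ E]

theorem ConvexOn.lipschitzOnWith_of_le_on_finset {f : E → ℝ} (hf : ConvexOn ℝ univ f)
    {u : Finset E} {R M m : ℝ} (hu : Metric.closedBall (0 : E) (R + 1) ⊆ convexHull ℝ (u : Set E))
    (hM : ∀ y ∈ u, f y ≤ M) (hm : m ≤ f 0) :
    LipschitzOnWith (2 * (|M| + 2 * |m|)).toNNReal f (Metric.ball 0 R) := by
  have hle : ∀ x ∈ Metric.closedBall (0 : E) (R + 1), f x ≤ M := by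
    have h := convexHull_min (s := (u : Set E)) (t := {x | x ∈ univ ∧ f x ≤ M})
      (fun y hy => ⟨mem_univ _, hM y hy⟩) (hf.convex_le M)
    exact fun x hx => (h (hu hx)).2
  have habs : ∀ x, dist x 0 < R + 1 → |f x| ≤ |M| + 2 * |m| := by
    intro x hx
    have h1 := hle x hx.le
    have h2 := hle (-x) (by simpa using hx.le)
    have h3 := hf.2 (mem_univ x) (mem_univ (-x)) (by norm_num : (0 : ℝ) ≤ 1 / 2)
      (by norm_num : (0 : ℝ) ≤ 1 / 2) (by norm_num)
    simp only [smul_neg, add_neg_cancel, smul_eq_mul] at h3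
    have := le_abs_self M
    have := neg_abs_le m
    have := abs_nonneg m
    exact abs_le.2 ⟨by linarith, by linarith⟩
  simpa using (hf.subset (subset_univ _) (convex_ball 0 (R + 1))).lipschitzOnWith_of_abs_le
    one_pos habs

variable [FiniteDimensional ℝ E] {ι : Type*} {l : Filter ι} {h : ι → E → ℝ} {h₀ : E → ℝ}

theorem eventually_sub_le_on_closedBall_of_convexOn (hc : ∀ q, ConvexOn ℝ univ (h q))
    (hc₀ : ConvexOn ℝ univ h₀) (ht : ∀ x, Tendsto (fun q => h q x) l (nhds (h₀ x)))
    (R : ℝ) {ε : ℝ} (hε : 0 < ε) :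
    ∀ᶠ q in l, ∀ x ∈ Metric.closedBall (0 : E) R, h₀ x - ε ≤ h q x := by
  obtain ⟨u, hu, -⟩ := (convex_closedBall (0 : E)
    (R + 1 + 1)).exists_subset_interior_convexHull_finset_of_isCompact
      (isCompact_closedBall (0 : E) (R + 1 + 1)) univ_mem
  replace hu := hu.trans interior_subset
  obtain ⟨M, hM⟩ : ∃ M, ∀ y ∈ u, h₀ y < M := by
    obtain ⟨M, hM⟩ := (u.image h₀).exists_le
    exact ⟨M + 1, fun y hy => (hM _ (Finset.mem_image_of_mem _ hy)).trans_lt (lt_add_one _)⟩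
  set C := (2 * (|M| + 2 * |h₀ 0 - 1|)).toNNReal
  have hL₀ : LipschitzOnWith C h₀ (Metric.ball 0 (R + 1)) :=
    hc₀.lipschitzOnWith_of_le_on_finset hu (fun y hy => (hM y hy).le) (by linarith)
  set ρ := ε / (3 * (C + 1)) with hρ
  have hρ0 : 0 < ρ := by positivity
  have hCρ : C * ρ ≤ ε / 3 := by
    rw [hρ, mul_div_assoc', div_le_div_iff₀ (by positivity) (by positivity)]
    nlinarith [C.coe_nonneg]
  obtain ⟨t, hts, htf, htc⟩ := (isCompact_closedBall (0 : E) R).finite_cover_balls hρ0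
  have e1 : ∀ᶠ q in l, ∀ y ∈ u, h q y < M :=
    (Finset.eventually_all u).2 fun y hy => (ht y).eventually_lt_const (hM y hy)
  have e2 : ∀ᶠ q in l, h₀ 0 - 1 < h q 0 := (ht 0).eventually_const_lt (by linarith)
  have e3 : ∀ᶠ q in l, ∀ y ∈ t, h₀ y - ε / 3 < h q y :=
    htf.eventually_all.2 fun y hy => (ht y).eventually_const_lt (by linarith)
  filter_upwards [e1, e2, e3] with q h1 h2 h3 x hx
  have hL := (hc q).lipschitzOnWith_of_le_on_finset hu (fun y hy => (h1 y hy).le) h2.le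
  obtain ⟨y, hy, hxy⟩ := mem_iUnion₂.1 (htc hx)
  have hsub : Metric.closedBall (0 : E) R ⊆ Metric.ball 0 (R + 1) :=
    Metric.closedBall_subset_ball (by linarith)
  have k1 := hL.dist_le_mul x (hsub hx) y (hsub (hts hy))
  have k2 := hL₀.dist_le_mul x (hsub hx) y (hsub (hts hy))
  have k3 : C * dist x y ≤ C * ρ :=
    mul_le_mul_of_nonneg_left (Metric.mem_ball.1 hxy).le C.coe_nonneg
  rw [Real.dist_eq] at k1 k2
  have k4 := (abs_le.1 k1).1
  have k5 := (abs_le.1 k2).2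
  have k6 := h3 y hy
  linarith

/-- A coercivity condition on a cone makes lower bounds stable under pointwise convergence of
convex functions. -/
theorem eventually_sub_le_of_convexOn_of_coercive (hc : ∀ q, ConvexOn ℝ univ (h q))
    (hc₀ : ConvexOn ℝ univ h₀) (ht : ∀ x, Tendsto (fun q => h q x) l (nhds (h₀ x)))
    {K : Set E} (hK0 : (0 : E) ∈ K) (hK : ∀ x ∈ K, ∀ s : ℝ, 0 ≤ s → s • x ∈ K)
    {R : ℝ} (hR : 0 < R) (hcoer : ∀ x ∈ K, ‖x‖ = R → h₀ 0 + 1 ≤ h₀ x)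
    {m : ℝ} (hm : ∀ x ∈ K, m ≤ h₀ x) {ε : ℝ} (hε : 0 < ε) :
    ∀ᶠ q in l, ∀ x ∈ K, m - ε ≤ h q x := by
  filter_upwards [eventually_sub_le_on_closedBall_of_convexOn hc hc₀ ht R hε,
    eventually_sub_le_on_closedBall_of_convexOn hc hc₀ ht R (ε := 1 / 2) (by norm_num),
    (ht 0).eventually_lt_const (show h₀ 0 < h₀ 0 + 1 / 2 by linarith)] with q h1 h2 h3 x hx
  have hball : ∀ y ∈ K, ‖y‖ ≤ R → m - ε ≤ h q y := fun y hy hyR => by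
    have := h1 y (by simpa using hyR)
    linarith [hm y hy]
  by_cases hxR : ‖x‖ ≤ R
  · exact hball x hx hxR
  push Not at hxR
  have hx0 : 0 < ‖x‖ := hR.trans hxR
  set s := R / ‖x‖ with hs
  have hs0 : 0 < s := div_pos hR hx0
  have hs1 : s ≤ 1 := ((div_lt_one hx0).2 hxR).le
  have hsx : ‖s • x‖ = R := by
    rw [norm_smul, Real.norm_of_nonneg hs0.le, hs, div_mul_cancel₀ _ hx0.ne']
  have k1 := hcoer _ (hK x hx s hs0.le) hsx
  have k2 := h2 (s • x) (by simpa using hsx.le)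
  have k3 := (hc q).2 (mem_univ x) (mem_univ (0 : E)) hs0.le (sub_nonneg.2 hs1)
    (by ring : s + (1 - s) = 1)
  simp only [smul_zero, add_zero, smul_eq_mul] at k3
  have k4 := hball 0 hK0 (by simpa using hR.le)
  have k5 : 0 ≤ h q x - h q 0 := by
    by_contra! hneg
    nlinarith
  linarith

end Convex

namespace CFSens

section Conjugate

variable {φ : ℝ → ℝ}

/-- The conjugate `φ*` as a real-valued function. -/
def fstar (φ : ℝ → ℝ) (x : ℝ) : ℝ := (phiStar φ x).toReal

theorem PhiOne.nonneg_s19 (hφ : PhiOne φ) {t : ℝ} (ht : 0 ≤ t) : 0 ≤ φ t := by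
  have hd : HasDerivAt φ 0 1 := by
    have := ((hφ.smooth.differentiableOn (by norm_num)).differentiableAt
      (Ioi_mem_nhds one_pos)).hasDerivAt
    rwa [hφ.done] at this
  have hmin := hφ.sconvex.convexOn.isMinOn_of_rightDeriv_eq_zero (x := 1) (by simp)
    (hd.hasDerivWithinAt.derivWithin (uniqueDiffWithinAt_Ioi 1))
  have := isMinOn_iff.1 hmin t ht
  rwa [hφ.one] at this

theorem PhiOne.exists_upper_bound (hφ : PhiOne φ) (x : ℝ) :
    ∃ B : ℝ, ∀ t, 0 ≤ t → t * x - φ t ≤ B := by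
  obtain ⟨T, hT⟩ := eventually_atTop.1 (hφ.superlinear.eventually_ge_atTop x)
  refine ⟨max T 1 * |x|, fun t ht => ?_⟩
  have hx := abs_nonneg x
  have hx' := le_abs_self x
  have hm : 0 < max T 1 := lt_max_of_lt_right one_pos
  rcases le_total t (max T 1) with h | h
  · have := hφ.nonneg_s19 ht
    nlinarith
  · have h1 := hT t ((le_max_left _ _).trans h)
    rw [le_div_iff₀ (hm.trans_le h)] at h1
    nlinarith

theorem PhiOne.phiStar_eq (hφ : PhiOne φ) (x : ℝ) : phiStar φ x = (fstar φ x : EReal) := by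
  obtain ⟨B, hB⟩ := hφ.exists_upper_bound x
  refine (EReal.coe_toReal (fun h => ?_) (fun h => ?_)).symm
  · have : phiStar φ x ≤ (B : EReal) := iSup₂_le fun t ht => EReal.coe_le_coe_iff.2 (hB t ht)
    rw [h] at this
    exact EReal.coe_ne_top B (top_le_iff.1 this)
  · have : ((0 * x - φ 0 : ℝ) : EReal) ≤ phiStar φ x :=
      le_iSup₂ (f := fun t (_ : t ∈ Set.Ici (0 : ℝ)) => ((t * x - φ t : ℝ) : EReal)) 0
        (mem_Ici.2 le_rfl)
    rw [h] at this
    exact EReal.coe_ne_bot _ (le_bot_iff.1 this)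

theorem PhiOne.le_fstar (hφ : PhiOne φ) (x : ℝ) {t : ℝ} (ht : 0 ≤ t) :
    t * x - φ t ≤ fstar φ x := by
  rw [← EReal.coe_le_coe_iff, ← hφ.phiStar_eq]
  exact le_iSup₂ (f := fun t (_ : t ∈ Set.Ici (0 : ℝ)) => ((t * x - φ t : ℝ) : EReal)) t ht

theorem PhiOne.fstar_le (hφ : PhiOne φ) {x b : ℝ} (h : ∀ t, 0 ≤ t → t * x - φ t ≤ b) :
    fstar φ x ≤ b := by
  rw [← EReal.coe_le_coe_iff, ← hφ.phiStar_eq]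
  exact iSup₂_le fun t ht => EReal.coe_le_coe_iff.2 (h t ht)

theorem PhiOne.self_le_fstar (hφ : PhiOne φ) (x : ℝ) : x ≤ fstar φ x := by
  simpa [hφ.one] using hφ.le_fstar x zero_le_one

theorem PhiOne.neg_le_fstar (hφ : PhiOne φ) (x : ℝ) : -φ 0 ≤ fstar φ x := by
  simpa using hφ.le_fstar x le_rfl

theorem PhiOne.fstar_mono (hφ : PhiOne φ) : Monotone (fstar φ) := fun x y hxy =>
  hφ.fstar_le fun t ht => by
    have := hφ.le_fstar y ht
    nlinarith

theorem PhiOne.fstar_convexOn (hφ : PhiOne φ) : ConvexOn ℝ univ (fstar φ) := by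
  refine ⟨convex_univ, fun x _ y _ a b ha hb hab => hφ.fstar_le fun t ht => ?_⟩
  have h1 := mul_le_mul_of_nonneg_left (hφ.le_fstar x ht) ha
  have h2 := mul_le_mul_of_nonneg_left (hφ.le_fstar y ht) hb
  obtain rfl : b = 1 - a := by linarith
  simp only [smul_eq_mul]
  nlinarith

end Conjugate

section Heart

variable {U : Type*} [MeasurableSpace U] {φ : ℝ → ℝ} {μ : Measure U}

/-- Membership in the Orlicz heart, in terms of integrability of `φ*(c|f|)`. -/
def MemHeart (φ : ℝ → ℝ) (μ : Measure U) (f : U → ℝ) : Prop :=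
  Measurable f ∧ ∀ c : ℝ, 0 ≤ c → Integrable (fun u => fstar φ (c * |f u|)) μ

theorem PhiOne.integrable_fstar (hφ : PhiOne φ) [IsFiniteMeasure μ] {f : U → ℝ}
    (hf : MemHeart φ μ f) : Integrable (fun u => fstar φ (f u)) μ := by
  refine ((hf.2 1 zero_le_one).add (integrable_const (φ 0))).mono'
    (hφ.fstar_mono.measurable.comp hf.1).aestronglyMeasurable (ae_of_all _ fun u => ?_)
  have h1 := hφ.neg_le_fstar (f u)
  have h2 := hφ.fstar_mono (le_abs_self (f u))
  have h3 := hφ.self_le_fstar |f u|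
  have h4 := hφ.nonneg_s19 (le_refl (0 : ℝ))
  have h5 := abs_nonneg (f u)
  simp only [Pi.add_apply, one_mul, Real.norm_eq_abs]
  exact abs_le.2 ⟨by linarith, by linarith⟩

theorem PhiOne.integrable_of_memHeart (hφ : PhiOne φ) {f : U → ℝ}
    (hf : MemHeart φ μ f) : Integrable f μ :=
  (hf.2 1 zero_le_one).mono' hf.1.aestronglyMeasurable
    (ae_of_all _ fun u => by simpa using hφ.self_le_fstar |f u|)

theorem memHeart_const [IsFiniteMeasure μ] (a : ℝ) :
    MemHeart φ μ (fun _ => a) :=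
  ⟨measurable_const, fun _ _ => integrable_const _⟩

theorem MemHeart.const_mul {f : U → ℝ} (hf : MemHeart φ μ f) (a : ℝ) :
    MemHeart φ μ (fun u => a * f u) := by
  refine ⟨hf.1.const_mul a, fun c hc => ?_⟩
  have := hf.2 (c * |a|) (by positivity)
  simpa only [abs_mul, mul_assoc] using this

theorem PhiOne.memHeart_add (hφ : PhiOne φ) {f₁ f₂ : U → ℝ}
    (h₁ : MemHeart φ μ f₁) (h₂ : MemHeart φ μ f₂) : MemHeart φ μ (fun u => f₁ u + f₂ u) := by
  refine ⟨h₁.1.add h₂.1, fun c hc => ?_⟩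
  refine (((h₁.2 (2 * c) (by positivity)).const_mul (1 / 2)).add
    ((h₂.2 (2 * c) (by positivity)).const_mul (1 / 2))).mono' (hφ.fstar_mono.measurable.comp
      (measurable_const.mul (measurable_norm.comp (h₁.1.add h₂.1)))).aestronglyMeasurable
      (ae_of_all _ fun u => ?_)
  have h0 : 0 ≤ c * |f₁ u + f₂ u| := mul_nonneg hc (abs_nonneg _)
  rw [Real.norm_of_nonneg (h0.trans (hφ.self_le_fstar _))]
  have k1 : c * |f₁ u + f₂ u| ≤ 1 / 2 * (2 * c * |f₁ u|) + 1 / 2 * (2 * c * |f₂ u|) := by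
    have := mul_le_mul_of_nonneg_left (abs_add_le (f₁ u) (f₂ u)) hc
    linarith
  exact (hφ.fstar_mono k1).trans (hφ.fstar_convexOn.2 (mem_univ _) (mem_univ _)
    (by norm_num : (0 : ℝ) ≤ 1 / 2) (by norm_num : (0 : ℝ) ≤ 1 / 2) (by norm_num))

theorem PhiOne.memHeart_dot (hφ : PhiOne φ) [IsFiniteMeasure μ] {n : ℕ} (a : Fin n → ℝ)
    {f : U → Fin n → ℝ} (hf : ∀ i, MemHeart φ μ (fun u => f u i)) :
    MemHeart φ μ (fun u => dot a (f u)) := by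
  have := Finset.sum_induction (fun i u => a i * f u i) (MemHeart φ μ)
    (fun _ _ => hφ.memHeart_add) (memHeart_const 0) (s := Finset.univ)
    fun i _ => (hf i).const_mul (a i)
  convert this using 2 with u
  simp [dot]

theorem PhiOne.memHeart_of_memE (hφ : PhiOne φ) [IsFiniteMeasure μ] {f : U → ℝ}
    (hf : MemE φ μ f) : MemHeart φ μ f := by
  refine ⟨hf.1, fun c hc => ?_⟩
  rcases hc.eq_or_lt with rfl | hc
  · simp
  have hm : Measurable fun u => c * |f u| := measurable_const.mul (measurable_norm.comp hf.1)
  have h1 := hf.2 c hc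
  have h2 : ∀ x, erealToENNReal (psi φ x) = ENNReal.ofReal (fstar φ x - x) := fun x => by
    rw [psi, hφ.phiStar_eq, ← EReal.coe_sub, erealToENNReal, if_neg (EReal.coe_ne_top _),
      EReal.toReal_coe]
  simp only [h2] at h1
  have h3 : Integrable (fun u => fstar φ (c * |f u|) - c * |f u|) μ :=
    (lintegral_ofReal_ne_top_iff_integrable
      ((hφ.fstar_mono.measurable.comp hm).sub hm).aestronglyMeasurable
      (ae_of_all _ fun u => sub_nonneg.2 (hφ.self_le_fstar _))).1 h1.ne
  have h4 : Integrable (fun u => c * |f u|) μ := by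
    refine (h3.add (integrable_const (φ 2))).mono' hm.aestronglyMeasurable
      (ae_of_all _ fun u => ?_)
    have := hφ.le_fstar (c * |f u|) zero_le_two
    rw [Real.norm_of_nonneg (by positivity)]
    simp only [Pi.add_apply]
    linarith
  exact (h3.add h4).congr (ae_of_all _ fun u => by simp)

theorem PhiOne.eExp_phiStar (hφ : PhiOne φ) [IsProbabilityMeasure μ] {f : U → ℝ}
    (hf : MemHeart φ μ f) :
    eExp μ (φ 0) (fun u => phiStar φ (f u)) = ((∫ u, fstar φ (f u) ∂μ : ℝ) : EReal) := by
  have h2 : ∀ x, erealToENNReal (phiStar φ x + (φ 0 : EReal)) = ENNReal.ofReal (fstar φ x + φ 0) :=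
    fun x => by
      rw [hφ.phiStar_eq, ← EReal.coe_add, erealToENNReal, if_neg (EReal.coe_ne_top _),
        EReal.toReal_coe]
  have hnn : ∀ u, 0 ≤ fstar φ (f u) + φ 0 := fun u => by linarith [hφ.neg_le_fstar (f u)]
  have hi := hφ.integrable_fstar hf
  simp only [eExp, h2]
  rw [← ofReal_integral_eq_lintegral_ofReal (f := fun u => fstar φ (f u) + φ 0)
      (hi.add (integrable_const _)) (ae_of_all _ hnn),
    EReal.coe_ennreal_ofReal, max_eq_left (integral_nonneg hnn), ← EReal.coe_sub,
    integral_add hi (integrable_const _)]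
  simp

/-- Integrated Fenchel–Young inequality. -/
theorem PhiOne.integral_le_integral_fstar_add_Dphi (hφ : PhiOne φ) [IsProbabilityMeasure μ]
    {F : Measure U} [IsProbabilityMeasure F] (hD : Dphi φ μ F < ⊤) {f : U → ℝ}
    (hf : MemHeart φ μ f) (hfF : Integrable f F) :
    ∫ u, f u ∂F ≤ (∫ u, fstar φ (f u) ∂μ) + (Dphi φ μ F).toReal := by
  have hac : F ≪ μ := by
    by_contra h
    simp [Dphi, h] at hD
  rw [Dphi, if_pos hac] at hD ⊢
  have hi := hφ.integrable_fstar hf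
  have hi' := (integrable_toReal_rnDeriv_mul_iff hac).2 hfF
  rw [← integral_toReal_rnDeriv_mul hac, ← sub_le_iff_le_add', ← integral_sub hi' hi,
    integral_eq_lintegral_pos_part_sub_lintegral_neg_part
      (f := fun u => (F.rnDeriv μ u).toReal * f u - fstar φ (f u)) (hi'.sub hi)]
  refine (sub_le_self _ ENNReal.toReal_nonneg).trans (ENNReal.toReal_mono hD.ne
    (lintegral_mono fun u => ENNReal.ofReal_le_ofReal ?_))
  have := hφ.le_fstar (f u) (t := (F.rnDeriv μ u).toReal) ENNReal.toReal_nonneg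
  linarith

end Heart

end CFSens

namespace CFSens

section Dual

variable {U : Type*} [MeasurableSpace U] {dθ d1 d2 d3 d4 : ℕ} {Γ : Type*}
  {φ : ℝ → ℝ} {μ : Measure U} {g : U → (Fin dθ → ℝ) → Γ → Vec4 d1 d2 d3 d4}

theorem dot4_add_left (a b v : Vec4 d1 d2 d3 d4) : dot4 (a + b) v = dot4 a v + dot4 b v := by
  simp only [dot4, dot, Prod.fst_add, Prod.snd_add, Pi.add_apply, add_mul, Finset.sum_add_distrib]
  ring

theorem dot4_smul_left (c : ℝ) (a v : Vec4 d1 d2 d3 d4) : dot4 (c • a) v = c * dot4 a v := by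
  simp only [dot4, dot, Prod.smul_fst, Prod.smul_snd, Pi.smul_apply, smul_eq_mul, mul_assoc,
    Finset.mul_sum, mul_add]

theorem dot4_comm (a b : Vec4 d1 d2 d3 d4) : dot4 a b = dot4 b a := by
  simp only [dot4, dot, mul_comm]

theorem dot4_neg_left (a v : Vec4 d1 d2 d3 d4) : dot4 (-a) v = -dot4 a v := by
  simpa using dot4_smul_left (-1) a v

theorem dot4_add_right (a v w : Vec4 d1 d2 d3 d4) : dot4 a (v + w) = dot4 a v + dot4 a w := by
  rw [dot4_comm, dot4_add_left, dot4_comm v, dot4_comm w]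

theorem dot4_smul_right (c : ℝ) (a v : Vec4 d1 d2 d3 d4) : dot4 a (c • v) = c * dot4 a v := by
  rw [dot4_comm, dot4_smul_left, dot4_comm v]

/-- The targeted moments padded by zeros. -/
def padZero (P : Vec12 d1 d2) : Vec4 d1 d2 d3 d4 := (P.1, P.2, 0, 0)

theorem dotP_eq_dot4 (l : Vec4 d1 d2 d3 d4) (P : Vec12 d1 d2) :
    dotP l P = dot4 l (padZero P) := by
  simp [dotP, dot4, padZero, dot]

/-- Pairing with a fixed vector as a linear map. -/
def dot4Linear (v : Vec4 d1 d2 d3 d4) : Vec4 d1 d2 d3 d4 →ₗ[ℝ] ℝ where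
  toFun l := dot4 l v
  map_add' a b := dot4_add_left a b v
  map_smul' c a := dot4_smul_left c a v

theorem exists_dot4_le_norm (v : Vec4 d1 d2 d3 d4) : ∃ C : ℝ, 0 ≤ C ∧ ∀ l, |dot4 l v| ≤ C * ‖l‖ :=
  ⟨‖LinearMap.toContinuousLinearMap (dot4Linear v)‖, norm_nonneg _,
    fun l => (LinearMap.toContinuousLinearMap (dot4Linear v)).le_opNorm l⟩

theorem sq_norm_le_dot {n : ℕ} (a : Fin n → ℝ) : ‖a‖ ^ 2 ≤ dot a a := by
  have h0 : 0 ≤ dot a a := Finset.sum_nonneg fun i _ => mul_self_nonneg _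
  refine (Real.le_sqrt (norm_nonneg _) h0).1
    ((pi_norm_le_iff_of_nonneg (Real.sqrt_nonneg _)).2 fun i => Real.le_sqrt_of_sq_le ?_)
  rw [Real.norm_eq_abs, sq_abs, sq]
  exact Finset.single_le_sum (f := fun i => a i * a i) (fun i _ => mul_self_nonneg _)
    (Finset.mem_univ i)

theorem sq_norm_le_dot4 (l : Vec4 d1 d2 d3 d4) : ‖l‖ ^ 2 ≤ dot4 l l := by
  have h1 := sq_norm_le_dot l.1
  have h2 := sq_norm_le_dot l.2.1
  have h3 := sq_norm_le_dot l.2.2.1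
  have h4 := sq_norm_le_dot l.2.2.2
  have k1 := sq_nonneg ‖l.1‖
  have k2 := sq_nonneg ‖l.2.1‖
  have k3 := sq_nonneg ‖l.2.2.1‖
  have k4 := sq_nonneg ‖l.2.2.2‖
  simp only [dot4]
  rw [Prod.norm_def, Prod.norm_def, Prod.norm_def]
  rcases max_choice ‖l.1‖ (max ‖l.2.1‖ (max ‖l.2.2.1‖ ‖l.2.2.2‖)) with h | h <;> rw [h]
  · linarith
  rcases max_choice ‖l.2.1‖ (max ‖l.2.2.1‖ ‖l.2.2.2‖) with h | h <;> rw [h]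
  · linarith
  rcases max_choice ‖l.2.2.1‖ ‖l.2.2.2‖ with h | h <;> rw [h] <;> linarith

theorem dot4_nonneg_of_inLambda {l c : Vec4 d1 d2 d3 d4} (hl : inLambda l) (hc : c ∈ coneC) :
    0 ≤ dot4 l c := by
  obtain ⟨h1, h2, h3, h4⟩ := hc
  simp only [dot4, h2, h4]
  have k1 : 0 ≤ dot l.1 c.1 := Finset.sum_nonneg fun i _ => mul_nonneg (hl.1 i) (h1 i)
  have k2 : 0 ≤ dot l.2.2.1 c.2.2.1 := Finset.sum_nonneg fun i _ => mul_nonneg (hl.2 i) (h3 i)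
  simp only [dot, Pi.zero_apply, mul_zero, Finset.sum_const_zero] at k1 k2 ⊢
  linarith

theorem integrable_dot {F : Measure U} {n : ℕ} (a : Fin n → ℝ) {f : U → Fin n → ℝ}
    (hf : ∀ i, Integrable (fun u => f u i) F) : Integrable (fun u => dot a (f u)) F :=
  integrable_finsetSum _ fun i _ => (hf i).const_mul _

theorem integral_dot {F : Measure U} {n : ℕ} (a : Fin n → ℝ) {f : U → Fin n → ℝ}
    (hf : ∀ i, Integrable (fun u => f u i) F) :
    ∫ u, dot a (f u) ∂F = dot a (fun i => ∫ u, f u i ∂F) := by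
  simp only [dot]
  rw [integral_finsetSum _ fun i _ => (hf i).const_mul _]
  simp only [integral_const_mul]

/-- The vector of moments `E^F[g(U,θ,γ)]`. -/
def moments (g : U → (Fin dθ → ℝ) → Γ → Vec4 d1 d2 d3 d4) (θ : Fin dθ → ℝ) (γ : Γ)
    (F : Measure U) : Vec4 d1 d2 d3 d4 :=
  ((fun i => ∫ u, (g u θ γ).1 i ∂F), (fun i => ∫ u, (g u θ γ).2.1 i ∂F),
    (fun i => ∫ u, (g u θ γ).2.2.1 i ∂F), (fun i => ∫ u, (g u θ γ).2.2.2 i ∂F))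

theorem integrable_dot4 {θ : Fin dθ → ℝ} {γ : Γ} {F : Measure U} (hF : GIntegrable g θ γ F)
    (l : Vec4 d1 d2 d3 d4) : Integrable (fun u => dot4 l (g u θ γ)) F :=
  (((integrable_dot l.1 hF.1).add (integrable_dot l.2.1 hF.2.1)).add
    (integrable_dot l.2.2.1 hF.2.2.1)).add (integrable_dot l.2.2.2 hF.2.2.2)

theorem integral_dot4 {θ : Fin dθ → ℝ} {γ : Γ} {F : Measure U} (hF : GIntegrable g θ γ F)
    (l : Vec4 d1 d2 d3 d4) : ∫ u, dot4 l (g u θ γ) ∂F = dot4 l (moments g θ γ F) := by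
  have h1 := integrable_dot l.1 hF.1
  have h2 := integrable_dot l.2.1 hF.2.1
  have h3 := integrable_dot l.2.2.1 hF.2.2.1
  have h4 := integrable_dot l.2.2.2 hF.2.2.2
  have e1 := integral_add (h1.add h2) h3
  have e2 := integral_add ((h1.add h2).add h3) h4
  simp only [Pi.add_apply] at e1 e2
  simp only [dot4, moments]
  rw [← integral_dot l.1 hF.1, ← integral_dot l.2.1 hF.2.1, ← integral_dot l.2.2.1 hF.2.2.1,
    ← integral_dot l.2.2.2 hF.2.2.2, e2, e1, integral_add h1 h2]

/-- All components of `g(·,θ,γ)` lie in the Orlicz heart. -/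
def MemEComponents (φ : ℝ → ℝ) (μ : Measure U) (g : U → (Fin dθ → ℝ) → Γ → Vec4 d1 d2 d3 d4)
    (θ : Fin dθ → ℝ) (γ : Γ) : Prop :=
  (∀ i, MemE φ μ (fun u => (g u θ γ).1 i)) ∧
  (∀ i, MemE φ μ (fun u => (g u θ γ).2.1 i)) ∧
  (∀ i, MemE φ μ (fun u => (g u θ γ).2.2.1 i)) ∧
  (∀ i, MemE φ μ (fun u => (g u θ γ).2.2.2 i))

theorem MemEComponents.gIntegrable (hφ : PhiOne φ) [IsFiniteMeasure μ] {θ : Fin dθ → ℝ} {γ : Γ}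
    (hg : MemEComponents φ μ g θ γ) : GIntegrable g θ γ μ :=
  ⟨fun i => hφ.integrable_of_memHeart (hφ.memHeart_of_memE (hg.1 i)),
    fun i => hφ.integrable_of_memHeart (hφ.memHeart_of_memE (hg.2.1 i)),
    fun i => hφ.integrable_of_memHeart (hφ.memHeart_of_memE (hg.2.2.1 i)),
    fun i => hφ.integrable_of_memHeart (hφ.memHeart_of_memE (hg.2.2.2 i))⟩

theorem MemEComponents.memHeart (hφ : PhiOne φ) [IsFiniteMeasure μ] {θ : Fin dθ → ℝ} {γ : Γ}
    (hg : MemEComponents φ μ g θ γ) (c : ℝ) (l : Vec4 d1 d2 d3 d4) :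
    MemHeart φ μ (fun u => c + dot4 l (g u θ γ)) :=
  hφ.memHeart_add (memHeart_const c) (hφ.memHeart_add (hφ.memHeart_add (hφ.memHeart_add
    (hφ.memHeart_dot l.1 fun i => hφ.memHeart_of_memE (hg.1 i))
    (hφ.memHeart_dot l.2.1 fun i => hφ.memHeart_of_memE (hg.2.1 i)))
    (hφ.memHeart_dot l.2.2.1 fun i => hφ.memHeart_of_memE (hg.2.2.1 i)))
    (hφ.memHeart_dot l.2.2.2 fun i => hφ.memHeart_of_memE (hg.2.2.2 i)))

/-- The negative of the dual objective at the multipliers `x = (ζ,λ)`. -/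
def negDual (φ : ℝ → ℝ) (μ : Measure U) (g : U → (Fin dθ → ℝ) → Γ → Vec4 d1 d2 d3 d4)
    (q : (Fin dθ → ℝ) × Γ × Vec12 d1 d2) (x : ℝ × Vec4 d1 d2 d3 d4) : ℝ :=
  (∫ u, fstar φ (-x.1 + dot4 (-x.2) (g u q.1 q.2.1)) ∂μ) + x.1 + dotP x.2 q.2.2

theorem deltaStar_eq_sSup_negDual (hφ : PhiOne φ) [IsFiniteMeasure μ] {θ : Fin dθ → ℝ} {γ : Γ}
    (hg : MemEComponents φ μ g θ γ) (P : Vec12 d1 d2) :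
    deltaStar φ μ g θ γ P =
      sSup ((fun x => ((-negDual φ μ g (θ, γ, P) x : ℝ) : EReal)) '' {x | inLambda x.2}) := by
  have harg : ∀ (ζ : ℝ) (l : Vec4 d1 d2 d3 d4) u,
      -ζ - dot4 l (g u θ γ) = -ζ + dot4 (-l) (g u θ γ) := fun ζ l u => by
    rw [dot4_neg_left, sub_eq_add_neg]
  refine congrArg sSup (Set.ext fun y => ⟨?_, ?_⟩)
  · rintro ⟨ζ, l, hl, w, -, hw, rfl⟩
    refine ⟨(ζ, l), hl, ?_⟩
    have hw' : w =ᵐ[μ] fun u => fstar φ (-ζ + dot4 (-l) (g u θ γ)) := by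
      filter_upwards [hw] with u hu
      rwa [hφ.phiStar_eq, EReal.coe_eq_coe_iff, harg] at hu
    simp only [negDual]
    rw [integral_congr_ae hw']
    congr 1
    ring
  · rintro ⟨⟨ζ, l⟩, hl, rfl⟩
    refine ⟨ζ, l, hl, _, hφ.integrable_fstar (hg.memHeart hφ (-ζ) (-l)),
      ae_of_all _ fun u => by rw [hφ.phiStar_eq, harg], ?_⟩
    simp only [negDual]
    congr 1
    ring

theorem negDual_convexOn (hφ : PhiOne φ) [IsFiniteMeasure μ]
    {q : (Fin dθ → ℝ) × Γ × Vec12 d1 d2} (hg : MemEComponents φ μ g q.1 q.2.1) :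
    ConvexOn ℝ univ (negDual φ μ g q) := by
  refine ⟨convex_univ, fun x _ y _ a b ha hb hab => ?_⟩
  have hint := fun x : ℝ × Vec4 d1 d2 d3 d4 =>
    hφ.integrable_fstar (hg.memHeart hφ (-x.1) (-x.2))
  have h1 : ∫ u, fstar φ (-(a • x + b • y).1 + dot4 (-(a • x + b • y).2) (g u q.1 q.2.1)) ∂μ ≤
      a * (∫ u, fstar φ (-x.1 + dot4 (-x.2) (g u q.1 q.2.1)) ∂μ) +
      b * ∫ u, fstar φ (-y.1 + dot4 (-y.2) (g u q.1 q.2.1)) ∂μ := by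
    rw [← integral_const_mul, ← integral_const_mul,
      ← integral_add ((hint x).const_mul a) ((hint y).const_mul b)]
    refine integral_mono (hint _) (((hint x).const_mul a).add ((hint y).const_mul b)) fun u => ?_
    have := hφ.fstar_convexOn.2 (mem_univ (-x.1 + dot4 (-x.2) (g u q.1 q.2.1)))
      (mem_univ (-y.1 + dot4 (-y.2) (g u q.1 q.2.1))) ha hb hab
    refine le_trans (le_of_eq (congrArg _ ?_)) this
    simp only [Prod.fst_add, Prod.snd_add, Prod.smul_fst, Prod.smul_snd, smul_eq_mul,
      dot4_neg_left, dot4_add_left, dot4_smul_left]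
    ring
  have h2 : dotP (a • x + b • y).2 q.2.2 = a * dotP x.2 q.2.2 + b * dotP y.2 q.2.2 := by
    simp only [dotP_eq_dot4, Prod.snd_add, Prod.smul_snd, dot4_add_left, dot4_smul_left]
  simp only [negDual, h2, smul_eq_mul]
  simp only [Prod.fst_add, Prod.smul_fst, smul_eq_mul] at h1 ⊢
  linarith

theorem tendsto_negDual [TopologicalSpace Γ] (hφ : PhiOne φ) [IsProbabilityMeasure μ]
    (hg : ∀ θ γ, MemEComponents φ μ g θ γ)
    (hcont : ∀ (c1 : ℝ) (c2 : Vec4 d1 d2 d3 d4),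
      Continuous (fun p : (Fin dθ → ℝ) × Γ =>
        eExp μ (φ 0) (fun u => phiStar φ (c1 + dot4 c2 (g u p.1 p.2)))))
    (q₀ : (Fin dθ → ℝ) × Γ × Vec12 d1 d2) (x : ℝ × Vec4 d1 d2 d3 d4) :
    Tendsto (fun q => negDual φ μ g q x) (nhds q₀) (nhds (negDual φ μ g q₀ x)) := by
  have h1 : Continuous fun p : (Fin dθ → ℝ) × Γ =>
      ∫ u, fstar φ (-x.1 + dot4 (-x.2) (g u p.1 p.2)) ∂μ := by
    have := hcont (-x.1) (-x.2)
    simp only [fun p : (Fin dθ → ℝ) × Γ =>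
      hφ.eExp_phiStar ((hg p.1 p.2).memHeart hφ (-x.1) (-x.2))] at this
    exact EReal.isEmbedding_coe.continuous_iff.2 this
  have h2 : Continuous fun q : (Fin dθ → ℝ) × Γ × Vec12 d1 d2 => dotP x.2 q.2.2 := by
    simp only [dotP, dot]
    fun_prop
  have h3 : Continuous fun q : (Fin dθ → ℝ) × Γ × Vec12 d1 d2 => negDual φ μ g q x :=
    ((h1.comp (continuous_fst.prodMk continuous_snd.fst)).add continuous_const).add h2
  exact h3.tendsto q₀

/-- Weak duality with perturbed moments. -/
theorem exists_dot4_le_negDual (hφ : PhiOne φ) [IsProbabilityMeasure μ]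
    {q : (Fin dθ → ℝ) × Γ × Vec12 d1 d2} (hg : MemEComponents φ μ g q.1 q.2.1)
    {v : Vec4 d1 d2 d3 d4} (hv : v ∈ momentSet φ μ g q.1 q.2.1 + coneC) :
    ∃ D : ℝ, ∀ x : ℝ × Vec4 d1 d2 d3 d4, inLambda x.2 →
      dotP x.2 q.2.2 - dot4 x.2 v - D ≤ negDual φ μ g q x := by
  obtain ⟨_, ⟨F, hF, hD, hgF, rfl⟩, c, hc, rfl⟩ := hv
  refine ⟨(Dphi φ μ F).toReal, fun x hx => ?_⟩
  have h1 := hφ.integral_le_integral_fstar_add_Dphi hD (hg.memHeart hφ (-x.1) (-x.2))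
    ((integrable_const _).add (integrable_dot4 hgF _))
  rw [integral_add (integrable_const _) (integrable_dot4 hgF _), integral_dot4 hgF,
    dot4_neg_left] at h1
  simp only [integral_const, probReal_univ, smul_eq_mul, one_mul] at h1
  have h2 := dot4_nonneg_of_inLambda hx hc
  simp only [negDual]
  change _ - dot4 x.2 (moments g q.1 q.2.1 F + c) - _ ≤ _
  rw [dot4_add_right]
  linarith

theorem exists_norm_le_negDual (hφ : PhiOne φ) [IsProbabilityMeasure μ]
    {q : (Fin dθ → ℝ) × Γ × Vec12 d1 d2} (hg : MemEComponents φ μ g q.1 q.2.1)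
    (hS : ConditionS φ μ g q.1 q.2.1 q.2.2) :
    ∃ ε D : ℝ, 0 < ε ∧ ∀ x : ℝ × Vec4 d1 d2 d3 d4, inLambda x.2 →
      ε * ‖x.2‖ - D ≤ negDual φ μ g q x := by
  set p : Vec4 d1 d2 d3 d4 := padZero q.2.2 with hp
  have hS' : momentSet φ μ g q.1 q.2.1 + coneC ∈ nhdsSet {p} := by
    rw [nhdsSet_singleton]
    exact mem_interior_iff_mem_nhds.1 hS
  obtain ⟨t, hpt, hts⟩ :=
    (convex_singleton (𝕜 := ℝ) p).exists_subset_interior_convexHull_finset_of_isCompact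
      isCompact_singleton hS'
  obtain ⟨ε, hε, hball⟩ := Metric.nhds_basis_closedBall.mem_iff.1
    (mem_interior_iff_mem_nhds.1 (hpt rfl))
  choose! D hD using fun v (hv : v ∈ t) =>
    exists_dot4_le_negDual hφ hg (hts (subset_convexHull ℝ _ hv))
  obtain ⟨M, hM⟩ := (t.image D).exists_le
  refine ⟨ε, M, hε, fun x hx => ?_⟩
  have hhull : ∀ v ∈ convexHull ℝ (t : Set (Vec4 d1 d2 d3 d4)),
      dotP x.2 q.2.2 - dot4 x.2 v - M ≤ negDual φ μ g q x := by
    refine fun v hv => convexHull_min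
      (t := {v | dotP x.2 q.2.2 - dot4 x.2 v - M ≤ negDual φ μ g q x}) (fun v hv => ?_) ?_ hv
    · have h1 := hD v hv x hx
      have h2 := hM _ (Finset.mem_image_of_mem D hv)
      simp only [mem_ofPred_eq]
      linarith
    · intro v hv w hw a b ha hb hab
      simp only [mem_ofPred_eq, dot4_add_right, dot4_smul_right] at hv hw ⊢
      obtain rfl : b = 1 - a := by linarith
      nlinarith [mul_le_mul_of_nonneg_left hv ha, mul_le_mul_of_nonneg_left hw hb]
  rcases (norm_nonneg x.2).eq_or_lt with h0 | h0
  · have := hhull p (hball (Metric.mem_closedBall_self hε.le))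
    rw [dotP_eq_dot4, ← hp] at this
    rw [← h0]
    linarith
  · have hmem : p + (-(ε / ‖x.2‖)) • x.2 ∈ Metric.closedBall p ε := by
      rw [mem_closedBall_iff_norm, add_sub_cancel_left, norm_smul, norm_neg, Real.norm_eq_abs,
        abs_of_pos (div_pos hε h0), div_mul_cancel₀ _ h0.ne']
    have h1 := hhull _ (hball hmem)
    rw [dotP_eq_dot4, ← hp, dot4_add_right, dot4_smul_right] at h1
    have h2 := mul_le_mul_of_nonneg_left (sq_norm_le_dot4 x.2) (div_pos hε h0).le
    have h3 : ε / ‖x.2‖ * ‖x.2‖ ^ 2 = ε * ‖x.2‖ := by field_simp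
    linarith

theorem exists_abs_le_negDual (hφ : PhiOne φ) [IsProbabilityMeasure μ]
    {q : (Fin dθ → ℝ) × Γ × Vec12 d1 d2} (hg : MemEComponents φ μ g q.1 q.2.1) :
    ∃ C D : ℝ, ∀ x : ℝ × Vec4 d1 d2 d3 d4, |x.1| - C * ‖x.2‖ - D ≤ negDual φ μ g q x := by
  obtain ⟨A, hA, hAx⟩ := exists_dot4_le_norm (d1 := d1) (d2 := d2) (d3 := d3) (d4 := d4)
    (padZero q.2.2)
  obtain ⟨B, hB, hBx⟩ := exists_dot4_le_norm (moments g q.1 q.2.1 μ)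
  have hi := hg.gIntegrable hφ
  refine ⟨A + 2 * B, φ 0 + φ 2, fun x => ?_⟩
  have hf := hg.memHeart hφ (-x.1) (-x.2)
  have hbase : ∀ t : ℝ, 0 ≤ t → t * (-x.1 - dot4 x.2 (moments g q.1 q.2.1 μ)) - φ t ≤
      ∫ u, fstar φ (-x.1 + dot4 (-x.2) (g u q.1 q.2.1)) ∂μ := by
    intro t ht
    have h1 := integral_mono (((hφ.integrable_of_memHeart hf).const_mul t).sub
      (integrable_const (φ t))) (hφ.integrable_fstar hf) fun u => hφ.le_fstar _ ht
    simp only [Pi.sub_apply] at h1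
    rwa [integral_sub ((hφ.integrable_of_memHeart hf).const_mul t) (integrable_const _),
      integral_const_mul, integral_add (integrable_const _) (integrable_dot4 hi _),
      integral_dot4 hi, dot4_neg_left, integral_const, integral_const, probReal_univ, one_smul,
      one_smul, ← sub_eq_add_neg] at h1
  have h0 := hbase 0 le_rfl
  have h2 := hbase 2 zero_le_two
  have k1 := abs_le.1 (hAx x.2)
  have k2 := abs_le.1 (hBx x.2)
  have k3 := mul_nonneg hB (norm_nonneg x.2)
  have k4 := hφ.nonneg_s19 (le_refl (0 : ℝ))
  have k5 := hφ.nonneg_s19 (zero_le_two (α := ℝ))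
  simp only [negDual, dotP_eq_dot4]
  rcases abs_cases x.1 with ⟨h, -⟩ | ⟨h, -⟩ <;> rw [h] <;> linarith [k1.1, k1.2, k2.1, k2.2]

theorem exists_radius_negDual (hφ : PhiOne φ) [IsProbabilityMeasure μ]
    {q : (Fin dθ → ℝ) × Γ × Vec12 d1 d2} (hg : MemEComponents φ μ g q.1 q.2.1)
    (hS : ConditionS φ μ g q.1 q.2.1 q.2.2) :
    ∃ R : ℝ, 0 < R ∧ ∀ x : ℝ × Vec4 d1 d2 d3 d4, inLambda x.2 → ‖x‖ = R →
      negDual φ μ g q 0 + 1 ≤ negDual φ μ g q x := by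
  obtain ⟨ε, D, hε, h1⟩ := exists_norm_le_negDual hφ hg hS
  obtain ⟨C, D', h2⟩ := exists_abs_le_negDual hφ hg
  set a := (|C| + 1) / ε with ha
  have ha0 : 0 < a := by positivity
  have haε : a * ε = |C| + 1 := div_mul_cancel₀ _ hε.ne'
  set S := a * D + D' + (a + 1) * (negDual φ μ g q 0 + 1)
  refine ⟨max S 1, lt_max_of_lt_right one_pos, fun x hx hxR => ?_⟩
  have k1 := mul_le_mul_of_nonneg_left (h1 x hx) ha0.le
  have k2 := h2 x
  have k3 : ‖x‖ ≤ |x.1| + ‖x.2‖ := by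
    rw [Prod.norm_def]
    exact max_le_add_of_nonneg (norm_nonneg _) (norm_nonneg _)
  have k4 := mul_le_mul_of_nonneg_right (le_abs_self C) (norm_nonneg x.2)
  have k5 : a * (ε * ‖x.2‖ - D) = |C| * ‖x.2‖ + ‖x.2‖ - a * D := by
    rw [mul_sub, ← mul_assoc, haε]
    ring
  have k6 : S ≤ ‖x‖ := hxR ▸ le_max_left S 1
  have k7 : (a + 1) * (negDual φ μ g q 0 + 1) ≤ (a + 1) * negDual φ μ g q x := by linarith
  exact le_of_mul_le_mul_left k7 (by linarith)

end Dual

end CFSens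

open CFSens

/-- **Appendix Lemma: continuity of the minimal divergence function.**
Under Assumptions Φ(i) and Φ(ii), if `(θ,γ) ↦ E^{F*}[φ*(c1 + c2'g(U,θ,γ))]` is continuous
for every `(c1,c2) ∈ ℝ × ℝ^d` and Condition S holds at `(θ,γ,P)`, then
`(θ̃,γ̃,P̃) ↦ δ*(θ̃;γ̃,P̃)` is continuous at `(θ,γ,P)`. -/
theorem continuity_minimal_divergence
    {U : Type*} [MeasurableSpace U] {dθ d1 d2 d3 d4 : ℕ} {Γ : Type*} [MetricSpace Γ]
    (φ : ℝ → ℝ) (Fstar : Measure U) [IsProbabilityMeasure Fstar]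
    (g : U → (Fin dθ → ℝ) → Γ → Vec4 d1 d2 d3 d4)
    (hΦ1 : PhiOne φ)
    (hΦ2g : ∀ (θ : Fin dθ → ℝ) (γ : Γ),
      (∀ i, MemE φ Fstar (fun u => (g u θ γ).1 i)) ∧
      (∀ i, MemE φ Fstar (fun u => (g u θ γ).2.1 i)) ∧
      (∀ i, MemE φ Fstar (fun u => (g u θ γ).2.2.1 i)) ∧
      (∀ i, MemE φ Fstar (fun u => (g u θ γ).2.2.2 i)))
    (hcont : ∀ (c1 : ℝ) (c2 : Vec4 d1 d2 d3 d4),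
      Continuous (fun p : (Fin dθ → ℝ) × Γ =>
        eExp Fstar (φ 0) (fun u => phiStar φ (c1 + dot4 c2 (g u p.1 p.2)))))
    (θ : Fin dθ → ℝ) (γ : Γ) (P : Vec12 d1 d2)
    (hS : ConditionS φ Fstar g θ γ P) :
    ContinuousAt
      (fun q : (Fin dθ → ℝ) × Γ × Vec12 d1 d2 => deltaStar φ Fstar g q.1 q.2.1 q.2.2)
      (θ, γ, P) := by
  have hg : ∀ θ γ, MemEComponents φ Fstar g θ γ := hΦ2g
  set q₀ : (Fin dθ → ℝ) × Γ × Vec12 d1 d2 := (θ, γ, P)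
  have ht := tendsto_negDual hΦ1 hg hcont q₀
  have heq := fun q : (Fin dθ → ℝ) × Γ × Vec12 d1 d2 =>
    deltaStar_eq_sSup_negDual hΦ1 (hg q.1 q.2.1) q.2.2
  simp only [ContinuousAt, heq]
  refine tendsto_order.2 ⟨fun a ha => ?_, fun a ha => ?_⟩
  · obtain ⟨_, ⟨x, hx, rfl⟩, hax⟩ := lt_sSup_iff.1 ha
    have := (continuous_coe_real_ereal.tendsto _).comp (ht x).neg
    filter_upwards [this.eventually_const_lt hax] with q hq
    exact hq.trans_le (le_sSup ⟨x, hx, rfl⟩)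
  · obtain ⟨b, hb, hba⟩ := EReal.lt_iff_exists_real_btwn.1 ha
    obtain ⟨c, hc, hcb⟩ := EReal.lt_iff_exists_real_btwn.1 hb
    rw [EReal.coe_lt_coe_iff] at hcb
    obtain ⟨R, hR, hcoer⟩ := exists_radius_negDual hΦ1 (q := q₀) (hg θ γ) hS
    have hm : ∀ x ∈ {x : ℝ × Vec4 d1 d2 d3 d4 | inLambda x.2}, -c ≤ negDual φ Fstar g q₀ x := by
      intro x hx
      have h1 := (le_sSup (mem_image_of_mem (fun x : ℝ × Vec4 d1 d2 d3 d4 =>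
        ((-negDual φ Fstar g q₀ x : ℝ) : EReal)) hx)).trans hc.le
      rw [EReal.coe_le_coe_iff] at h1
      linarith
    have hev := eventually_sub_le_of_convexOn_of_coercive
      (fun q => negDual_convexOn hΦ1 (hg q.1 q.2.1)) (negDual_convexOn hΦ1 (hg q₀.1 q₀.2.1)) ht
      (K := {x | inLambda x.2}) ⟨fun _ => le_rfl, fun _ => le_rfl⟩
      (fun x hx s hs => ⟨fun i => mul_nonneg hs (hx.1 i), fun i => mul_nonneg hs (hx.2 i)⟩)
      hR hcoer hm (sub_pos.2 hcb)
    filter_upwards [hev] with q hq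
    refine lt_of_le_of_lt (sSup_le ?_) hba
    rintro _ ⟨x, hx, rfl⟩
    have := hq x hx
    exact EReal.coe_le_coe_iff.2 (by linarith)
end
end
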